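/- arXiv:2511.16910 — 2 statements merged into one kernel-verified Lean document; each statement's English description precedes it below -/
import Mathlib

section
/- Let d₁, d₂, d₃ be odd positive integers. Equip the exterior algebra Λ = Λ_ℚ(ℚ³) on the standard basis e₁, e₂, e₃ with the weighted grading in which, for n ∈ ℕ, the degree-n component Λ_n is the ℚ-span of the monomials e_σ with Σ_{i∈σ} d_i = n (σ ⊆ {1,2,3}). Suppose A ⊆ Λ is a subring that, as an additive group, is generated by a ℚ-basis of Λ consisting of homogeneous elements of this grading. Then there exist elements b₁, b₂, b₃ ∈ A, each homogeneous, whose degrees are (d₁, d₂, d₃) up to a permutation, and positive integers c₁₂, c₁₃, c₂₃, c₁₂₃ with c₁₂ ∣ c₁₂₃, c₁₃ ∣ c₁₂₃, c₂₃ ∣ c₁₂₃, such that A equals the additive subgroup of Λ generated by {1, b₁, b₂, b₃, (1/c₁₂)·b₁b₂, (1/c₁₃)·b₁b₃, (1/c₂₃)·b₂b₃, (1/c₁₂₃)·b₁b₂b₃}. -/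
noncomputable section

/-- The exterior algebra `Λ_ℚ(ℚ³)`. -/
abbrev Lambda3 : Type := ExteriorAlgebra ℚ (Fin 3 → ℚ)

/-- The images `e₁, e₂, e₃` of the standard basis vectors of `ℚ³`. -/
def e3 (i : Fin 3) : Lambda3 := ExteriorAlgebra.ι ℚ (Pi.single i 1)

/-- The monomial `e_σ`: product of the `e_i` over `i ∈ σ`, in increasing order. -/
def eMon (σ : Finset (Fin 3)) : Lambda3 := ((σ.sort (· ≤ ·)).map e3).prod

/-- The weighted degree-`n` component: the `ℚ`-span of the monomials `e_σ`
with `∑_{i ∈ σ} d i = n`. -/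
def wComp (d : Fin 3 → ℕ) (n : ℕ) : Submodule ℚ Lambda3 :=
  Submodule.span ℚ {x | ∃ σ : Finset (Fin 3), (∑ i ∈ σ, d i) = n ∧ x = eMon σ}

section Lattices

variable {W : Type} [AddCommGroup W] [Module ℚ W]

/-- Full lattices in a rational vector space. -/
structure FullLat (L : Submodule ℤ W) : Prop where
  fg : L.FG
  full : ∀ v : W, ∃ n : ℕ, 0 < n ∧ (n : ℤ) • v ∈ L

theorem full_of_span (L : Submodule ℤ W) (s : Set W) (hs : ∀ x ∈ s, x ∈ L)
    (hspan : Submodule.span ℚ s = ⊤) (v : W) : ∃ n : ℕ, 0 < n ∧ (n : ℤ) • v ∈ L := by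
  have hv : v ∈ Submodule.span ℚ s := by rw [hspan]; trivial
  induction hv using Submodule.span_induction with
  | mem x hx => exact ⟨1, one_pos, by simpa using hs x hx⟩
  | zero => exact ⟨1, one_pos, by simp⟩
  | add x y _ _ hx hy =>
    obtain ⟨n, hn, hnx⟩ := hx
    obtain ⟨m, hm, hmy⟩ := hy
    refine ⟨n * m, Nat.mul_pos hn hm, ?_⟩
    have h : ((n * m : ℕ) : ℤ) • (x + y) = (m : ℤ) • ((n : ℤ) • x) + (n : ℤ) • ((m : ℤ) • y) := by
      push_cast
      module
    rw [h]
    exact L.add_mem (L.smul_mem _ hnx) (L.smul_mem _ hmy)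
  | smul q x _ hx =>
    obtain ⟨n, hn, hnx⟩ := hx
    refine ⟨q.den * n, Nat.mul_pos q.den_pos hn, ?_⟩
    have h : ((q.den * n : ℕ) : ℤ) • (q • x) = (q.num : ℤ) • ((n : ℤ) • x) := by
      rw [← Int.cast_smul_eq_zsmul ℚ, ← Int.cast_smul_eq_zsmul ℚ, ← Int.cast_smul_eq_zsmul ℚ,
        smul_smul, smul_smul]
      congr 1
      push_cast
      have := Rat.den_mul_eq_num q
      linear_combination (n : ℚ) * this
    rw [h]
    exact L.smul_mem _ hnx

theorem fullLat_of_basis {κ : Type} [Finite κ] (b : Module.Basis κ ℚ W) :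
    FullLat (Submodule.span ℤ (Set.range b)) where
  fg := Submodule.fg_span (Set.finite_range b)
  full := full_of_span _ (Set.range b) (fun _ hx => Submodule.subset_span hx) b.span_eq

theorem exists_latBasis {L : Submodule ℤ W} (hL : FullLat L) {κ : Type} [Finite κ]
    (bL : Module.Basis κ ℤ L) : ∃ b : Module.Basis κ ℚ W, ∀ i, b i = bL i := by
  have h1 : LinearIndependent ℤ (fun i => (bL i : W)) :=
    bL.linearIndependent.map' L.subtype (by simp)
  have h2 : LinearIndependent ℚ (fun i => (bL i : W)) :=
    (LinearIndependent.iff_fractionRing ℤ ℚ).1 h1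
  have h3 : ⊤ ≤ Submodule.span ℚ (Set.range fun i => (bL i : W)) := by
    intro v _
    obtain ⟨n, hn, hv⟩ := hL.full v
    have h4 : (n : ℤ) • v ∈ Submodule.span ℚ (Set.range fun i => (bL i : W)) := by
      have h5 := bL.linearCombination_repr ⟨_, hv⟩
      have h6 := congrArg (Subtype.val) h5
      rw [Finsupp.linearCombination_apply, Finsupp.sum] at h6
      simp only [Submodule.coe_sum, Submodule.coe_smul] at h6
      rw [← h6]
      refine Submodule.sum_mem _ fun i _ => ?_
      rw [← Int.cast_smul_eq_zsmul ℚ]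
      exact Submodule.smul_mem _ _ (Submodule.subset_span ⟨i, rfl⟩)
    rw [← Int.cast_smul_eq_zsmul ℚ] at h4
    have h7 := Submodule.smul_mem _ ((n : ℚ)⁻¹) h4
    rw [smul_smul] at h7
    have hn' : (n : ℚ) ≠ 0 := by positivity
    simpa [hn'] using h7
  exact ⟨Module.Basis.mk h2 h3, fun i => by simp⟩

theorem FullLat.free {L : Submodule ℤ W} (hL : FullLat L) :
    ∃ n : ℕ, Nonempty (Module.Basis (Fin n) ℤ L) := by
  have : Module.Finite ℤ L := Module.Finite.of_fg hL.fg
  have : Module.IsTorsionFree ℤ W := Module.IsTorsionFree.trans_faithfulSMul ℤ ℚ W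
  exact ⟨_, ⟨(Module.basisOfFiniteTypeTorsionFree' (R := ℤ) (M := L)).2⟩⟩

theorem FullLat.finrank {L : Submodule ℤ W} (hL : FullLat L) :
    Module.finrank ℤ L = Module.finrank ℚ W := by
  obtain ⟨n, ⟨bL⟩⟩ := hL.free
  obtain ⟨b, -⟩ := exists_latBasis hL bL
  rw [Module.finrank_eq_card_basis bL, Module.finrank_eq_card_basis b]

theorem exists_mult {L N : Submodule ℤ W} (hL : FullLat L) (hN : FullLat N) :
    ∃ k : ℕ, 0 < k ∧ ∀ x ∈ N, (k : ℤ) • x ∈ L := by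
  obtain ⟨S, hS⟩ := hN.fg
  choose f hf hf' using hL.full
  refine ⟨∏ x ∈ S, f x, Finset.prod_pos fun x _ => hf x, fun x hx => ?_⟩
  rw [← hS] at hx
  induction hx using Submodule.span_induction with
  | mem x hx =>
    obtain ⟨m, hm⟩ := Finset.dvd_prod_of_mem f hx
    rw [hm]
    push_cast
    rw [mul_comm, mul_smul]
    exact L.smul_mem _ (hf' x)
  | zero => simp
  | add x y _ _ hx hy => rw [smul_add]; exact L.add_mem hx hy
  | smul q x _ hx => rw [smul_comm]; exact L.smul_mem _ hx

theorem span_basis_coe {κ : Type} {L : Submodule ℤ W} (bL : Module.Basis κ ℤ L) :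
    Submodule.span ℤ (Set.range fun i => (bL i : W)) = L := by
  have h := congrArg (Submodule.map L.subtype) bL.span_eq
  rw [Submodule.map_span, ← Set.range_comp, Submodule.map_top, Submodule.range_subtype] at h
  exact h

/-- Simultaneous bases of two full lattices. -/
theorem smith {κ : Type} [Fintype κ] (b0 : Module.Basis κ ℚ W) {L N : Submodule ℤ W}
    (hL : FullLat L) (hN : FullLat N) :
    ∃ (b : κ → W) (c : κ → ℚ), (∀ i, c i ≠ 0) ∧
      L = Submodule.span ℤ (Set.range b) ∧
      N = Submodule.span ℤ (Set.range fun i => c i • b i) := by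
  obtain ⟨k, hk, hkN⟩ := exists_mult hL hN
  obtain ⟨n, ⟨bL⟩⟩ := hL.free
  have hn : n = Fintype.card κ := by
    have h := hL.finrank
    rw [Module.finrank_eq_card_basis bL, Module.finrank_eq_card_basis b0] at h
    simpa using h
  subst hn
  let bL' : Module.Basis κ ℤ L := bL.reindex (Fintype.equivFin κ).symm
  have hkq : (k : ℚ) ≠ 0 := by positivity
  let f : W →ₗ[ℤ] W := LinearMap.lsmul ℤ W (k : ℤ)
  have hf : ∀ x, f x = (k : ℚ) • x := fun x => by
    simp [f, Nat.cast_smul_eq_nsmul]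
  let N' : Submodule ℤ W := N.map f
  have hN'L : N' ≤ L := by
    rintro _ ⟨x, hx, rfl⟩
    exact hkN x hx
  have hN' : FullLat N' := by
    refine ⟨hN.fg.map f, fun v => ?_⟩
    obtain ⟨m, hm, hmv⟩ := hN.full v
    refine ⟨k * m, Nat.mul_pos hk hm, ⟨_, hmv, ?_⟩⟩
    simp [f, mul_smul, smul_comm m k v]
  have hr : Module.finrank ℤ (N'.comap L.subtype) = Module.finrank ℤ L := by
    rw [hL.finrank, ← hN'.finrank]
    exact LinearEquiv.finrank_eq (Submodule.comapSubtypeEquivOfLe hN'L)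
  obtain ⟨b', a, ab', hab⟩ := Submodule.exists_smith_normal_form_of_rank_eq bL' hr
  let bN' : Module.Basis κ ℤ N' := ab'.map (Submodule.comapSubtypeEquivOfLe hN'L)
  have hbN' : ∀ i, (bN' i : W) = (a i : ℚ) • (b' i : W) := fun i => by
    have h := congrArg Subtype.val (hab i)
    rw [Int.cast_smul_eq_zsmul ℚ]
    simpa [bN'] using h
  refine ⟨fun i => b' i, fun i => (a i : ℚ) / k, fun i => ?_, (span_basis_coe b').symm, ?_⟩
  · have h : (a i : ℚ) ≠ 0 := by
      intro h
      have h2 := hbN' i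
      rw [h, zero_smul] at h2
      exact bN'.ne_zero i (Subtype.ext h2)
    exact div_ne_zero h hkq
  · have h := span_basis_coe bN'
    have hinj : Function.Injective f := fun x y hxy => by
      rw [hf, hf] at hxy
      exact smul_right_injective W hkq hxy
    apply Submodule.map_injective_of_injective hinj
    change N' = _
    rw [← h, Submodule.map_span, ← Set.range_comp]
    congr 2
    funext i
    simp only [Function.comp, hbN', hf, smul_smul]
    congr 1
    field_simp

end Lattices

section Graded

variable (d : Fin 3 → ℕ)

/-- Restriction of a vector to the coordinates of weight `δ`. -/
def part (δ : ℕ) (x : Fin 3 → ℚ) : Fin 3 → ℚ := fun i => if d i = δ then x i else 0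

/-- Extension by zero. -/
def ext0 (δ : ℕ) : ({i : Fin 3 // d i = δ} → ℚ) →ₗ[ℤ] (Fin 3 → ℚ) where
  toFun x i := if h : d i = δ then x ⟨i, h⟩ else 0
  map_add' x y := by
    funext i
    by_cases h : d i = δ <;> simp [h]
  map_smul' c x := by
    funext i
    by_cases h : d i = δ <;> simp [h]

theorem ext0_restr (δ : ℕ) (x : Fin 3 → ℚ) : ext0 d δ (fun i => x i) = part d δ x := by
  funext i
  by_cases h : d i = δ <;> simp [h, ext0, part]

theorem ext0_inj (δ : ℕ) : Function.Injective (ext0 d δ) := by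
  intro x y h
  funext i
  have h2 := congrFun h i
  simpa [ext0, i.2] using h2

theorem sum_part (x : Fin 3 → ℚ) : x = ∑ δ ∈ Finset.univ.image d, part d δ x := by
  funext i
  rw [Finset.sum_apply]
  simp [part]

theorem fullLat_comap {U W : Type} [AddCommGroup U] [Module ℚ U] [AddCommGroup W] [Module ℚ W]
    {L : Submodule ℤ W} (hL : FullLat L) (f : U →ₗ[ℤ] W) (hf : Function.Injective f) :
    FullLat (L.comap f) := by
  constructor
  · refine Submodule.fg_of_fg_map_injective f hf ?_
    have : Module.Finite ℤ L := Module.Finite.of_fg hL.fg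
    exact Submodule.FG.of_le_of_isNoetherian (Submodule.map_comap_le f L)
  · intro v
    obtain ⟨n, hn, h⟩ := hL.full (f v)
    exact ⟨n, hn, by simpa using h⟩

theorem graded_smith {L N : Submodule ℤ (Fin 3 → ℚ)} (hL : FullLat L) (hN : FullLat N)
    (gL : ∀ x ∈ L, ∀ i, part d (d i) x ∈ L) (gN : ∀ x ∈ N, ∀ i, part d (d i) x ∈ N) :
    ∃ (b : Fin 3 → Fin 3 → ℚ) (c : Fin 3 → ℚ), (∀ i, c i ≠ 0) ∧
      (∀ i j, d j ≠ d i → b i j = 0) ∧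
      L = Submodule.span ℤ (Set.range b) ∧
      N = Submodule.span ℤ (Set.range fun i => c i • b i) := by
  have key := fun δ : ℕ => smith (Pi.basisFun ℚ {i : Fin 3 // d i = δ})
    (fullLat_comap hL (ext0 d δ) (ext0_inj d δ)) (fullLat_comap hN (ext0 d δ) (ext0_inj d δ))
  choose B C hC hBL hBN using key
  have aux : ∀ (K : Submodule ℤ (Fin 3 → ℚ)) (gK : ∀ x ∈ K, ∀ i, part d (d i) x ∈ K)
      (B' : ∀ δ, {i : Fin 3 // d i = δ} → ({i : Fin 3 // d i = δ} → ℚ))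
      (hB : ∀ δ, K.comap (ext0 d δ) = Submodule.span ℤ (Set.range (B' δ))),
      K = Submodule.span ℤ (Set.range fun i => ext0 d (d i) (B' (d i) ⟨i, rfl⟩)) := by
    intro K gK B' hB
    apply le_antisymm
    · intro x hx
      rw [sum_part d x]
      refine Submodule.sum_mem _ fun δ hδ => ?_
      obtain ⟨j, -, rfl⟩ := Finset.mem_image.1 hδ
      have h1 : (fun i : {i : Fin 3 // d i = d j} => x i) ∈ K.comap (ext0 d (d j)) := by
        rw [Submodule.mem_comap, ext0_restr]
        exact gK x hx j
      rw [hB] at h1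
      have h2 := Submodule.mem_map_of_mem (f := ext0 d (d j)) h1
      rw [ext0_restr, Submodule.map_span, ← Set.range_comp] at h2
      refine Submodule.span_mono ?_ h2
      rintro _ ⟨⟨i, hi⟩, rfl⟩
      refine ⟨i, ?_⟩
      have : ∀ δ (h : d i = δ), ext0 d (d i) (B' (d i) ⟨i, rfl⟩) = ext0 d δ (B' δ ⟨i, h⟩) := by
        rintro _ rfl
        rfl
      exact this _ hi
    · rw [Submodule.span_le]
      rintro _ ⟨i, rfl⟩
      have : B' (d i) ⟨i, rfl⟩ ∈ K.comap (ext0 d (d i)) := by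
        rw [hB]
        exact Submodule.subset_span ⟨_, rfl⟩
      exact this
  refine ⟨fun i => ext0 d (d i) (B (d i) ⟨i, rfl⟩), fun i => C (d i) ⟨i, rfl⟩,
    fun i => hC _ _, fun i j h => by simp [ext0, h], aux L gL B hBL, ?_⟩
  rw [aux N gN _ hBN]
  congr 2
  funext i j
  by_cases h : d j = d i <;> simp [ext0, h]

end Graded

section Ext

/-- The monomial basis. -/
def eB : Module.Basis (Finset (Fin 3)) ℚ Lambda3 := (Pi.basisFun ℚ (Fin 3)).ExteriorAlgebra

theorem eB_apply (σ : Finset (Fin 3)) : eB σ = eMon σ := by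
  rw [eB, ExteriorAlgebra.basis_apply_ofCard _ rfl, ExteriorAlgebra.ιMulti_family,
    ExteriorAlgebra.ιMulti_apply, eMon, Set.powersetCard.ofFinEmbEquiv_symm_apply,
    List.ofFn_eq_map, ← Finset.listMap_orderEmbOfFin_finRange σ rfl, List.map_map]
  congr 1
  apply List.map_congr_left
  intro i _
  simp [e3]

theorem eMon_empty : eMon ∅ = 1 := by simp [eMon]
theorem eMon_0 : eMon {0} = e3 0 := by simp [eMon]
theorem eMon_1 : eMon {1} = e3 1 := by simp [eMon]
theorem eMon_2 : eMon {2} = e3 2 := by simp [eMon]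
theorem eMon_01 : eMon {0, 1} = e3 0 * e3 1 := by
  have : ({0, 1} : Finset (Fin 3)).sort (· ≤ ·) = [0, 1] := by
    repeat rw [Finset.sort_insert (· ≤ ·) (by decide) (by decide)]
    rw [Finset.sort_singleton]
  simp [eMon, this]
theorem eMon_02 : eMon {0, 2} = e3 0 * e3 2 := by
  have : ({0, 2} : Finset (Fin 3)).sort (· ≤ ·) = [0, 2] := by
    repeat rw [Finset.sort_insert (· ≤ ·) (by decide) (by decide)]
    rw [Finset.sort_singleton]
  simp [eMon, this]
theorem eMon_12 : eMon {1, 2} = e3 1 * e3 2 := by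
  have : ({1, 2} : Finset (Fin 3)).sort (· ≤ ·) = [1, 2] := by
    repeat rw [Finset.sort_insert (· ≤ ·) (by decide) (by decide)]
    rw [Finset.sort_singleton]
  simp [eMon, this]
theorem eMon_012 : eMon {0, 1, 2} = e3 0 * e3 1 * e3 2 := by
  have : ({0, 1, 2} : Finset (Fin 3)).sort (· ≤ ·) = [0, 1, 2] := by
    repeat rw [Finset.sort_insert (· ≤ ·) (by decide) (by decide)]
    rw [Finset.sort_singleton]
  simp [eMon, this, mul_assoc]

/-- Inclusion of the degree one part. -/
def w1 (x : Fin 3 → ℚ) : Lambda3 := x 0 • eMon {0} + x 1 • eMon {1} + x 2 • eMon {2}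

/-- Inclusion of the degree two part. -/
def w2 : (Fin 3 → ℚ) →ₗ[ℚ] Lambda3 where
  toFun y := y 0 • eMon {1, 2} - y 1 • eMon {0, 2} + y 2 • eMon {0, 1}
  map_add' x y := by simp only [Pi.add_apply]; module
  map_smul' c x := by simp only [Pi.smul_apply, smul_eq_mul, RingHom.id_apply]; module

/-- The top monomial. -/
def top3 : Lambda3 := eMon {0, 1, 2}

theorem iota_eq (x : Fin 3 → ℚ) : ExteriorAlgebra.ι ℚ x = w1 x := by
  conv_lhs => rw [pi_eq_sum_univ' x]
  simp [Fin.sum_univ_three, w1, eMon_0, eMon_1, eMon_2, e3]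

theorem univ_finset3 : (Finset.univ : Finset (Finset (Fin 3))) =
    {∅, {0}, {1}, {2}, {0, 1}, {0, 2}, {1, 2}, {0, 1, 2}} := by decide

theorem decomp (a : Lambda3) : ∃ (q : ℚ) (x y : Fin 3 → ℚ) (t : ℚ),
    a = q • (1 : Lambda3) + ExteriorAlgebra.ι ℚ x + w2 y + t • top3 := by
  have h := eB.sum_repr a
  rw [univ_finset3] at h
  repeat rw [Finset.sum_insert (by decide)] at h
  rw [Finset.sum_singleton] at h
  simp only [eB_apply] at h
  refine ⟨eB.repr a ∅, ![eB.repr a {0}, eB.repr a {1}, eB.repr a {2}],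
    ![eB.repr a {1, 2}, - eB.repr a {0, 2}, eB.repr a {0, 1}], eB.repr a {0, 1, 2}, ?_⟩
  rw [← eMon_empty, iota_eq]
  simp only [w1, w2, top3, LinearMap.coe_mk, AddHom.coe_mk, Matrix.cons_val]
  refine h.symm.trans ?_
  module

theorem e3_sq (i : Fin 3) : e3 i * e3 i = 0 := ExteriorAlgebra.ι_sq_zero _

theorem e3_comm (i j : Fin 3) : e3 j * e3 i = - (e3 i * e3 j) :=
  eq_neg_of_add_eq_zero_left (by
    simpa [e3] using ExteriorAlgebra.ι_add_mul_swap (R := ℚ) (Pi.single j 1 : Fin 3 → ℚ) (Pi.single i 1))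

theorem iota_mul (x y : Fin 3 → ℚ) :
    ExteriorAlgebra.ι ℚ x * ExteriorAlgebra.ι ℚ y = w2 (crossProduct x y) := by
  rw [iota_eq, iota_eq, cross_apply]
  simp only [w1, w2, LinearMap.coe_mk, AddHom.coe_mk, Matrix.cons_val, eMon_0, eMon_1, eMon_2,
    eMon_01, eMon_02, eMon_12]
  simp only [add_mul, mul_add, smul_mul_smul_comm, e3_sq, e3_comm 0 1, e3_comm 0 2, e3_comm 1 2]
  module

theorem w2_mul (x y : Fin 3 → ℚ) :
    w2 y * ExteriorAlgebra.ι ℚ x = (x ⬝ᵥ y) • top3 := by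
  rw [iota_eq]
  have h1 : e3 1 * e3 2 * e3 0 = e3 0 * e3 1 * e3 2 := by
    rw [mul_assoc, e3_comm 0 2, mul_neg, ← mul_assoc, e3_comm 0 1]; simp
  have h2 : e3 1 * e3 2 * e3 1 = 0 := by
    rw [mul_assoc, e3_comm 1 2, mul_neg, ← mul_assoc, e3_sq]; simp
  have h3 : e3 1 * e3 2 * e3 2 = 0 := by rw [mul_assoc, e3_sq, mul_zero]
  have h4 : e3 0 * e3 2 * e3 0 = 0 := by
    rw [mul_assoc, e3_comm 0 2, mul_neg, ← mul_assoc, e3_sq]; simp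
  have h5 : e3 0 * e3 2 * e3 1 = - (e3 0 * e3 1 * e3 2) := by
    rw [mul_assoc, e3_comm 1 2, mul_neg, ← mul_assoc]
  have h6 : e3 0 * e3 2 * e3 2 = 0 := by rw [mul_assoc, e3_sq, mul_zero]
  have h7 : e3 0 * e3 1 * e3 0 = 0 := by
    rw [mul_assoc, e3_comm 0 1, mul_neg, ← mul_assoc, e3_sq]; simp
  have h8 : e3 0 * e3 1 * e3 1 = 0 := by rw [mul_assoc, e3_sq, mul_zero]
  simp only [w1, w2, LinearMap.coe_mk, AddHom.coe_mk, eMon_0, eMon_1, eMon_2, top3,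
    eMon_01, eMon_02, eMon_12, eMon_012, add_mul, sub_mul, mul_add, smul_mul_smul_comm,
    h1, h2, h3, h4, h5, h6, h7, h8, dotProduct, Fin.sum_univ_three]
  module

theorem top3_ne : top3 ≠ 0 := by
  rw [top3, ← eB_apply]
  exact eB.ne_zero _

variable (d : Fin 3 → ℕ)

open Classical in
/-- Projection onto the components with degrees in `S`. -/
def proj (S : Set ℕ) : Lambda3 →ₗ[ℚ] Lambda3 :=
  eB.constr ℚ fun σ => if (∑ i ∈ σ, d i) ∈ S then eMon σ else 0

open Classical in
theorem proj_eMon (S : Set ℕ) (σ : Finset (Fin 3)) :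
    proj d S (eMon σ) = if (∑ i ∈ σ, d i) ∈ S then eMon σ else 0 := by
  have h := eB.constr_basis ℚ (fun σ => if (∑ i ∈ σ, d i) ∈ S then eMon σ else 0) σ
  rw [eB_apply] at h
  exact h

open Classical in
theorem proj_wComp (S : Set ℕ) (n : ℕ) (z : Lambda3) (hz : z ∈ wComp d n) :
    proj d S z = if n ∈ S then z else 0 := by
  rw [wComp] at hz
  induction hz using Submodule.span_induction with
  | mem x hx =>
    obtain ⟨σ, rfl, rfl⟩ := hx
    exact proj_eMon d S σ
  | zero => simp
  | add x y _ _ hx hy => rw [map_add, hx, hy]; split_ifs <;> simp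
  | smul q x _ hx => rw [map_smul, hx]; split_ifs <;> simp

open Classical in
theorem proj_iota (S : Set ℕ) (x : Fin 3 → ℚ) :
    proj d S (ExteriorAlgebra.ι ℚ x) =
      ExteriorAlgebra.ι ℚ (fun i => if d i ∈ S then x i else 0) := by
  simp only [iota_eq, w1, map_add, map_smul, proj_eMon, Finset.sum_singleton]
  simp only [smul_ite, ite_smul, smul_zero, zero_smul]

open Classical in
theorem proj_w2 (S : Set ℕ) (y : Fin 3 → ℚ) :
    proj d S (w2 y) = w2 (fun i => if d 0 + d 1 + d 2 - d i ∈ S then y i else 0) := by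
  have h0 : d 0 + d 1 + d 2 - d 0 = d 1 + d 2 := by omega
  have h1 : d 0 + d 1 + d 2 - d 1 = d 0 + d 2 := by omega
  have h2 : d 0 + d 1 + d 2 - d 2 = d 0 + d 1 := by omega
  simp only [w2, LinearMap.coe_mk, AddHom.coe_mk, map_add, map_sub, map_smul, proj_eMon]
  rw [Finset.sum_pair (by decide), Finset.sum_pair (by decide), Finset.sum_pair (by decide)]
  simp only [smul_ite, ite_smul, smul_zero, zero_smul, h0, h1, h2]

open Classical in
theorem proj_one (S : Set ℕ) : proj d S 1 = if 0 ∈ S then 1 else 0 := by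
  rw [← eMon_empty, proj_eMon, Finset.sum_empty]

open Classical in
theorem proj_top (S : Set ℕ) : proj d S top3 = if d 0 + d 1 + d 2 ∈ S then top3 else 0 := by
  rw [top3, proj_eMon]
  have : ∑ i ∈ ({0, 1, 2} : Finset (Fin 3)), d i = d 0 + d 1 + d 2 := by
    rw [Finset.sum_insert (by decide), Finset.sum_pair (by decide), add_assoc]
  rw [this]

theorem iota_mem_wComp (x : Fin 3 → ℚ) (n : ℕ) (hx : ∀ j, d j ≠ n → x j = 0) :
    ExteriorAlgebra.ι ℚ x ∈ wComp d n := by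
  have h : ∀ j, x j • eMon {j} ∈ wComp d n := fun j => by
    by_cases hj : d j = n
    · exact Submodule.smul_mem _ _ (Submodule.subset_span ⟨{j}, by simpa using hj, rfl⟩)
    · rw [hx j hj, zero_smul]; exact Submodule.zero_mem _
  rw [iota_eq, w1]
  exact Submodule.add_mem _ (Submodule.add_mem _ (h 0) (h 1)) (h 2)

end Ext

section Core

theorem exists_dual {M : Submodule ℤ (Fin 3 → ℚ)} (hM : FullLat M) :
    ∃ N : Submodule ℤ (Fin 3 → ℚ), FullLat N ∧
      (∀ x, x ∈ N ↔ ∀ y ∈ M, ∃ n : ℤ, x ⬝ᵥ y = n) ∧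
      (∀ y, y ∈ M ↔ ∀ x ∈ N, ∃ n : ℤ, x ⬝ᵥ y = n) := by
  obtain ⟨n, ⟨bM⟩⟩ := hM.free
  obtain ⟨b, hb⟩ := exists_latBasis hM bM
  have hMb : M = Submodule.span ℤ (Set.range b) := by
    rw [← span_basis_coe bM]
    congr 2
    funext i
    exact (hb i).symm
  let B : LinearMap.BilinForm ℚ (Fin 3 → ℚ) := Matrix.toBilin' (1 : Matrix (Fin 3) (Fin 3) ℚ)
  have hB : B.Nondegenerate :=
    LinearMap.BilinForm.nondegenerate_toBilin'_of_det_ne_zero' _ (by simp)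
  have hBa : ∀ x y, B x y = x ⬝ᵥ y := fun x y => by
    simp [B, Matrix.toBilin'_apply']
  have hBs : B.IsSymm := ⟨fun x y => by rw [hBa, hBa, dotProduct_comm]⟩
  have hmem : ∀ (K : Submodule ℤ (Fin 3 → ℚ)) x, x ∈ B.dualSubmodule K ↔
      ∀ y ∈ K, ∃ n : ℤ, x ⬝ᵥ y = n := fun K x => by
    rw [LinearMap.BilinForm.mem_dualSubmodule]
    simp only [Submodule.mem_one, hBa]
    exact forall₂_congr fun y _ => exists_congr fun n => eq_comm
  refine ⟨B.dualSubmodule M, ?_, hmem M, fun y => ?_⟩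
  · rw [hMb, LinearMap.BilinForm.dualSubmodule_span_of_basis B hB b]
    exact fullLat_of_basis _
  · have h := LinearMap.BilinForm.dualSubmodule_dualSubmodule_of_basis (R := ℤ) B hB hBs b
    rw [← hMb] at h
    conv_lhs => rw [← h]
    rw [hmem]
    simp only [dotProduct_comm y]

theorem sign_aux (m : ℤ) (hm : m ≠ 0) :
    ∃ ε : ℤ, ε * ε = 1 ∧ (m : ℚ) = ε * (m.natAbs : ℚ) := by
  have h0 : (m.natAbs : ℚ) = |(m : ℚ)| := by
    rw [← Int.cast_abs, Int.abs_eq_natAbs, Int.cast_natCast]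
  rw [h0]
  rcases le_total 0 (m : ℚ) with h | h
  · exact ⟨1, by norm_num, by rw [abs_of_nonneg h]; simp⟩
  · exact ⟨-1, by norm_num, by rw [abs_of_nonpos h]; simp⟩

theorem core (d : Fin 3 → ℕ) {L M : Submodule ℤ (Fin 3 → ℚ)} (hL : FullLat L) (hM : FullLat M)
    (gL : ∀ x ∈ L, ∀ i, part d (d i) x ∈ L) (gM : ∀ x ∈ M, ∀ i, part d (d i) x ∈ M)
    (hLM : ∀ x ∈ L, ∀ y ∈ L, crossProduct x y ∈ M) :
    ∃ (b : Fin 3 → Fin 3 → ℚ) (k0 k1 k2 : ℕ),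
      (∀ i j, d j ≠ d i → b i j = 0) ∧
      L = Submodule.span ℤ (Set.range b) ∧
      b 2 ⬝ᵥ crossProduct (b 0) (b 1) ≠ 0 ∧ 0 < k0 ∧ 0 < k1 ∧ 0 < k2 ∧
      (k0 : ℚ)⁻¹ • crossProduct (b 1) (b 2) ∈ M ∧
      (k1 : ℚ)⁻¹ • crossProduct (b 0) (b 2) ∈ M ∧
      (k2 : ℚ)⁻¹ • crossProduct (b 0) (b 1) ∈ M ∧
      ∀ y ∈ M, ∃ n0 n1 n2 : ℤ, y = n0 • ((k0 : ℚ)⁻¹ • crossProduct (b 1) (b 2)) +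
        n1 • ((k1 : ℚ)⁻¹ • crossProduct (b 0) (b 2)) +
        n2 • ((k2 : ℚ)⁻¹ • crossProduct (b 0) (b 1)) := by
  obtain ⟨N, hN, hNM, hMN⟩ := exists_dual hM
  have gN : ∀ x ∈ N, ∀ i, part d (d i) x ∈ N := by
    intro x hx i
    rw [hNM]
    intro y hy
    obtain ⟨n, hn⟩ := (hNM x).1 hx _ (gM y hy i)
    refine ⟨n, hn ▸ ?_⟩
    simp [dotProduct, part]
  obtain ⟨b, c, hc, hbd, hLb, hNb⟩ := graded_smith d hL hN gL gN
  have hbL : ∀ i, b i ∈ L := fun i => by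
    rw [hLb]; exact Submodule.subset_span ⟨i, rfl⟩
  have hbN : ∀ i, c i • b i ∈ N := fun i => by
    rw [hNb]; exact Submodule.subset_span ⟨i, rfl⟩
  have hspan : ⊤ ≤ Submodule.span ℚ (Set.range b) := by
    intro v _
    obtain ⟨n, hn, hv⟩ := hL.full v
    rw [hLb] at hv
    have h4 : (n : ℤ) • v ∈ Submodule.span ℚ (Set.range b) :=
      Submodule.span_le_restrictScalars ℤ ℚ _ hv
    rw [← Int.cast_smul_eq_zsmul ℚ] at h4
    have h7 := Submodule.smul_mem _ ((n : ℚ)⁻¹) h4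
    rw [smul_smul] at h7
    have hn' : (n : ℚ) ≠ 0 := by positivity
    simpa [hn'] using h7
  have hli : LinearIndependent ℚ b := linearIndependent_of_top_le_span_of_card_eq_finrank hspan
    (by simp)
  have hdet : (Matrix.of b).det ≠ 0 := by
    have h := (Matrix.linearIndependent_rows_iff_isUnit (A := Matrix.of b)).1 hli
    rw [Matrix.isUnit_iff_isUnit_det] at h
    exact h.ne_zero
  have hdet2 : b 2 ⬝ᵥ crossProduct (b 0) (b 1) ≠ 0 := by
    intro h
    apply hdet
    rw [Matrix.det_fin_three, ← h, cross_apply]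
    simp [dotProduct, Fin.sum_univ_three]
    ring
  set Δ := b 2 ⬝ᵥ crossProduct (b 0) (b 1) with hΔ
  have e0 : b 0 ⬝ᵥ crossProduct (b 1) (b 2) = Δ := by
    simp [hΔ, cross_apply, dotProduct, Fin.sum_univ_three]; ring
  have e1 : b 1 ⬝ᵥ crossProduct (b 0) (b 2) = - Δ := by
    simp [hΔ, cross_apply, dotProduct, Fin.sum_univ_three]; ring
  have hcr : ∀ i j l, ∃ n : ℤ, c i * (b i ⬝ᵥ crossProduct (b j) (b l)) = n := by
    intro i j l
    obtain ⟨n, hn⟩ := (hNM _).1 (hbN i) _ (hLM _ (hbL j) _ (hbL l))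
    exact ⟨n, by rw [← hn, smul_dotProduct, smul_eq_mul]⟩
  obtain ⟨m0, h0⟩ := hcr 0 1 2
  obtain ⟨m1, h1⟩ := hcr 1 0 2
  obtain ⟨m2, h2⟩ := hcr 2 0 1
  rw [e0] at h0
  rw [e1] at h1
  rw [← hΔ] at h2
  have hm0 : m0 ≠ 0 := by
    rintro rfl; simp [hc, hdet2] at h0
  have hm1 : m1 ≠ 0 := by
    rintro rfl; simp [hc, hdet2] at h1
  have hm2 : m2 ≠ 0 := by
    rintro rfl; simp [hc, hdet2] at h2
  obtain ⟨ε0, hε0, hs0⟩ := sign_aux m0 hm0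
  obtain ⟨ε1, hε1, hs1⟩ := sign_aux m1 hm1
  obtain ⟨ε2, hε2, hs2⟩ := sign_aux m2 hm2
  have hk0 : 0 < m0.natAbs := Int.natAbs_pos.2 hm0
  have hk1 : 0 < m1.natAbs := Int.natAbs_pos.2 hm1
  have hk2 : 0 < m2.natAbs := Int.natAbs_pos.2 hm2
  generalize m0.natAbs = k0 at *
  generalize m1.natAbs = k1 at *
  generalize m2.natAbs = k2 at *
  have q0 : (k0 : ℚ) ≠ 0 := by positivity
  have q1 : (k1 : ℚ) ≠ 0 := by positivity
  have q2 : (k2 : ℚ) ≠ 0 := by positivity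
  have hint : ∀ y, (∀ i, ∃ n : ℤ, c i * (b i ⬝ᵥ y) = n) → y ∈ M := by
    intro y hy
    rw [hMN]
    intro x hx
    rw [hNb] at hx
    induction hx using Submodule.span_induction with
    | mem x hx =>
      obtain ⟨i, rfl⟩ := hx
      obtain ⟨n, hn⟩ := hy i
      exact ⟨n, by rw [← hn, smul_dotProduct, smul_eq_mul]⟩
    | zero => exact ⟨0, by simp⟩
    | add x y _ _ hx hy =>
      obtain ⟨n, hn⟩ := hx
      obtain ⟨m, hm⟩ := hy
      exact ⟨n + m, by rw [add_dotProduct, hn, hm]; push_cast; ring⟩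
    | smul q x _ hx =>
      obtain ⟨n, hn⟩ := hx
      exact ⟨q * n, by rw [smul_dotProduct, hn]; simp⟩
  have z1 : ∀ u v : Fin 3 → ℚ, u ⬝ᵥ crossProduct u v = 0 := dot_self_cross
  have z2 : ∀ u v : Fin 3 → ℚ, v ⬝ᵥ crossProduct u v = 0 := dot_cross_self
  refine ⟨b, k0, k1, k2, hbd, hLb, hdet2, hk0, hk1, hk2, hint _ ?_, hint _ ?_, hint _ ?_, ?_⟩
  · intro i
    simp only [dotProduct_smul, smul_eq_mul]
    fin_cases i
    · refine ⟨ε0, ?_⟩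
      simp only [Fin.zero_eta, e0]
      field_simp
      linear_combination h0 + hs0
    · exact ⟨0, by simp [z1]⟩
    · exact ⟨0, by simp [z2]⟩
  · intro i
    simp only [dotProduct_smul, smul_eq_mul]
    fin_cases i
    · exact ⟨0, by simp [z1]⟩
    · refine ⟨ε1, ?_⟩
      simp only [Fin.mk_one, e1]
      field_simp
      linear_combination h1 + hs1
    · exact ⟨0, by simp [z2]⟩
  · intro i
    simp only [dotProduct_smul, smul_eq_mul]
    fin_cases i
    · exact ⟨0, by simp [z1]⟩
    · exact ⟨0, by simp [z2]⟩
    · refine ⟨ε2, ?_⟩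
      simp only [Fin.reduceFinMk, ← hΔ]
      field_simp
      linear_combination h2 + hs2
  · intro y hy
    have hn : ∀ i, ∃ n : ℤ, c i * (b i ⬝ᵥ y) = n := by
      intro i
      obtain ⟨n, hn⟩ := (hNM _).1 (hbN i) _ hy
      exact ⟨n, by rw [← hn, smul_dotProduct, smul_eq_mul]⟩
    obtain ⟨n0, hn0⟩ := hn 0
    obtain ⟨n1, hn1⟩ := hn 1
    obtain ⟨n2, hn2⟩ := hn 2
    refine ⟨ε0 * n0, ε1 * n1, ε2 * n2, ?_⟩
    have hy' : y = (Δ⁻¹ * (b 0 ⬝ᵥ y)) • crossProduct (b 1) (b 2)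
        - (Δ⁻¹ * (b 1 ⬝ᵥ y)) • crossProduct (b 0) (b 2)
        + (Δ⁻¹ * (b 2 ⬝ᵥ y)) • crossProduct (b 0) (b 1) := by
      have : Δ • y = (b 0 ⬝ᵥ y) • crossProduct (b 1) (b 2)
        - (b 1 ⬝ᵥ y) • crossProduct (b 0) (b 2)
        + (b 2 ⬝ᵥ y) • crossProduct (b 0) (b 1) := by
        rw [hΔ]
        funext i
        fin_cases i <;> simp [cross_apply, dotProduct, Fin.sum_univ_three] <;> ring
      have h3 := congrArg (fun z => Δ⁻¹ • z) this
      simp only [smul_smul, inv_mul_cancel₀ hdet2, one_smul, smul_add, smul_sub] at h3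
      exact h3
    have key : ∀ (cc m n ε k D p : ℚ), cc ≠ 0 → k ≠ 0 → D ≠ 0 → ε * ε = 1 → cc * D = ε * k →
        cc * p = n → D⁻¹ * p = ε * n * k⁻¹ := by
      intro cc m n ε k D p hcc hk hD hε h1 h2
      field_simp
      apply mul_left_cancel₀ hcc
      linear_combination k * h2 - ε * n * h1 - n * k * hε
    have t0 := key (c 0) m0 n0 ε0 k0 Δ (b 0 ⬝ᵥ y) (hc 0) q0 hdet2 (by exact_mod_cast hε0)
      (h0.trans hs0) hn0
    have t1 := key (c 1) m1 n1 ε1 k1 (-Δ) (b 1 ⬝ᵥ y) (hc 1) q1 (neg_ne_zero.2 hdet2)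
      (by exact_mod_cast hε1) (h1.trans hs1) hn1
    have t2 := key (c 2) m2 n2 ε2 k2 Δ (b 2 ⬝ᵥ y) (hc 2) q2 hdet2 (by exact_mod_cast hε2)
      (h2.trans hs2) hn2
    have t1' : Δ⁻¹ * (b 1 ⬝ᵥ y) = - (ε1 * n1 * (k1 : ℚ)⁻¹) := by
      rw [← t1, inv_neg]; ring
    rw [t0, t1', t2] at hy'
    simp only [← Int.cast_smul_eq_zsmul ℚ, smul_smul]
    push_cast
    rw [neg_smul, sub_neg_eq_add] at hy'
    exact hy'

end Core

section Main

theorem w2_inj : Function.Injective w2 := by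
  rw [← LinearMap.ker_eq_bot, LinearMap.ker_eq_bot']
  intro y hy
  funext i
  have h := w2_mul (Pi.single i 1) y
  rw [hy, zero_mul] at h
  have h2 := (smul_eq_zero.1 h.symm).resolve_right top3_ne
  simpa using h2

theorem iota_inj : Function.Injective (ExteriorAlgebra.ι ℚ : (Fin 3 → ℚ) →ₗ[ℚ] Lambda3) :=
  ExteriorAlgebra.ι_leftInverse.injective

/-- The inclusion of the top degree part. -/
def w3 : ℚ →ₗ[ℚ] Lambda3 := LinearMap.toSpanSingleton ℚ Lambda3 top3

theorem w3_apply (t : ℚ) : w3 t = t • top3 := rfl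

theorem w3_inj : Function.Injective w3 := fun s t h => by
  rw [w3_apply, w3_apply] at h
  exact smul_left_injective ℚ top3_ne h

theorem rank_one {T : Submodule ℤ ℚ} (hT : FullLat T) (D : ℚ) (hD : D ≠ 0) (hDT : D ∈ T) :
    ∃ k : ℕ, 0 < k ∧ (k : ℚ)⁻¹ * D ∈ T ∧ ∀ t ∈ T, ∃ n : ℤ, t = n * ((k : ℚ)⁻¹ * D) := by
  obtain ⟨b, -, -, hb, -⟩ := smith (Module.Basis.singleton Unit ℚ) hT hT
  have hmem : ∀ t, t ∈ T ↔ ∃ n : ℤ, t = n * b () := fun t => by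
    rw [hb, Set.range_unique, Submodule.mem_span_singleton]
    simp [eq_comm]
  obtain ⟨m, hm⟩ := (hmem D).1 hDT
  have hm0 : m ≠ 0 := by
    rintro rfl
    simp at hm
    exact hD hm
  obtain ⟨ε, hε, hs⟩ := sign_aux m hm0
  have hk : 0 < m.natAbs := Int.natAbs_pos.2 hm0
  have hkq : (m.natAbs : ℚ) ≠ 0 := by positivity
  have hεq : (ε : ℚ) * ε = 1 := by exact_mod_cast hε
  have e : (m.natAbs : ℚ)⁻¹ * D = ε * b () := by
    rw [hm, hs]
    field_simp
  refine ⟨m.natAbs, hk, ?_, fun t ht => ?_⟩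
  · rw [hmem]
    exact ⟨ε, e⟩
  · obtain ⟨n, rfl⟩ := (hmem t).1 ht
    refine ⟨n * ε, ?_⟩
    rw [e]
    push_cast
    linear_combination (-(n : ℚ) * b ()) * hεq

theorem dvd_aux {k c : ℕ} (hk : 0 < k) (hc : 0 < c) {D : ℚ} (hD : D ≠ 0) {n : ℤ}
    (h : (k : ℚ)⁻¹ * D = n * ((c : ℚ)⁻¹ * D)) : k ∣ c := by
  have hk' : (k : ℚ) ≠ 0 := by positivity
  have hc' : (c : ℚ) ≠ 0 := by positivity
  have h2 : (c : ℚ) = k * n := by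
    field_simp at h
    linarith
  have h3 : (c : ℤ) = k * n := by exact_mod_cast h2
  exact Int.natCast_dvd_natCast.1 ⟨n, h3⟩

end Main

/-- Any order in the exterior algebra `Λ_ℚ(ℚ³)`, graded with odd
weights `d₁, d₂, d₃`, is a weighted sphere-product ring. -/
theorem stmt0 (d : Fin 3 → ℕ) (hpos : ∀ i, 0 < d i) (hodd : ∀ i, Odd (d i))
    (A : Subring Lambda3)
    (hA : ∃ s : Set Lambda3,
      LinearIndependent ℚ ((↑) : s → Lambda3) ∧
      Submodule.span ℚ s = ⊤ ∧
      (∀ x ∈ s, ∃ n : ℕ, x ∈ wComp d n) ∧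
      A.toAddSubgroup = AddSubgroup.closure s) :
    ∃ (b : Fin 3 → Lambda3) (π : Equiv.Perm (Fin 3)) (c12 c13 c23 c123 : ℕ),
      (∀ i, b i ∈ A) ∧
      (∀ i, b i ∈ wComp d (d (π i))) ∧
      0 < c12 ∧ 0 < c13 ∧ 0 < c23 ∧ 0 < c123 ∧
      c12 ∣ c123 ∧ c13 ∣ c123 ∧ c23 ∣ c123 ∧
      A.toAddSubgroup = AddSubgroup.closure
        ({1, b 0, b 1, b 2,
          (c12 : ℚ)⁻¹ • (b 0 * b 1), (c13 : ℚ)⁻¹ • (b 0 * b 2),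
          (c23 : ℚ)⁻¹ • (b 1 * b 2),
          (c123 : ℚ)⁻¹ • (b 0 * b 1 * b 2)} : Set Lambda3) := by
  classical
  obtain ⟨s, hli, hspan, hhom, hAs⟩ := hA
  have hsA : ∀ x ∈ s, x ∈ A := fun x hx => by
    have : x ∈ A.toAddSubgroup := by
      rw [hAs]; exact AddSubgroup.subset_closure hx
    exact this
  -- `A` is graded
  have hproj : ∀ (S : Set ℕ), ∀ a ∈ A, proj d S a ∈ A := by
    intro S a ha
    have ha' : a ∈ AddSubgroup.closure s := by rw [← hAs]; exact ha
    induction ha' using AddSubgroup.closure_induction with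
    | mem x hx =>
      obtain ⟨n, hn⟩ := hhom x hx
      rw [proj_wComp d S n x hn]
      split_ifs
      · exact hsA x hx
      · exact A.zero_mem
    | zero => rw [map_zero]; exact A.zero_mem
    | add x y hx hy h1 h2 =>
      rw [← hAs] at hx hy
      rw [map_add]; exact A.add_mem (h1 hx) (h2 hy)
    | neg x hx h1 =>
      rw [← hAs] at hx
      rw [map_neg]; exact A.neg_mem (h1 hx)
  let AZ : Submodule ℤ Lambda3 := AddSubgroup.toIntSubmodule A.toAddSubgroup
  have hfin : s.Finite := by
    have : FiniteDimensional ℚ Lambda3 := Module.Basis.finiteDimensional_of_finite eB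
    exact hli.setFinite
  have hAZ : FullLat AZ := by
    refine ⟨?_, full_of_span _ s hsA hspan⟩
    have : AZ = Submodule.span ℤ s := by
      apply le_antisymm
      · intro x hx
        have hx' : x ∈ A.toAddSubgroup := hx
        rw [hAs] at hx'
        have : AddSubgroup.closure s ≤ (Submodule.span ℤ s).toAddSubgroup :=
          (AddSubgroup.closure_le _).2 Submodule.subset_span
        exact this hx'
      · exact Submodule.span_le.2 hsA
    rw [this]
    exact Submodule.fg_span hfin
  let L := AZ.comap ((ExteriorAlgebra.ι ℚ : (Fin 3 → ℚ) →ₗ[ℚ] Lambda3).restrictScalars ℤ)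
  let M := AZ.comap (w2.restrictScalars ℤ)
  let T := AZ.comap (w3.restrictScalars ℤ)
  have hL : FullLat L := fullLat_comap hAZ _ iota_inj
  have hM : FullLat M := fullLat_comap hAZ _ w2_inj
  have hT : FullLat T := fullLat_comap hAZ _ w3_inj
  have mL : ∀ x, x ∈ L ↔ ExteriorAlgebra.ι ℚ x ∈ A := fun x => Iff.rfl
  have mM : ∀ x, x ∈ M ↔ w2 x ∈ A := fun x => Iff.rfl
  have mT : ∀ t, t ∈ T ↔ t • top3 ∈ A := fun x => Iff.rfl
  have gL : ∀ x ∈ L, ∀ i, part d (d i) x ∈ L := by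
    intro x hx i
    have h := hproj {d i} _ ((mL x).1 hx)
    rw [proj_iota] at h
    rw [mL]
    convert h using 3 with j
    simp only [part, Set.mem_singleton_iff]
  have gM : ∀ x ∈ M, ∀ i, part d (d i) x ∈ M := by
    intro x hx i
    have h := hproj {d 0 + d 1 + d 2 - d i} _ ((mM x).1 hx)
    rw [proj_w2] at h
    rw [mM]
    have hle : ∀ j, d j ≤ d 0 + d 1 + d 2 := fun j => by fin_cases j <;> simp <;> omega
    convert h using 3 with j
    have := hle i
    have := hle j
    have e : d 0 + d 1 + d 2 - d j ∈ ({d 0 + d 1 + d 2 - d i} : Set ℕ) ↔ d j = d i := by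
      rw [Set.mem_singleton_iff]; omega
    simp only [part, e]
  have hLM : ∀ x ∈ L, ∀ y ∈ L, crossProduct x y ∈ M := by
    intro x hx y hy
    rw [mM, ← iota_mul]
    exact A.mul_mem hx hy
  obtain ⟨b, k0, k1, k2, hbd, hLb, hD, hk0, hk1, hk2, hM0, hM1, hM2, hMy⟩ :=
    core d hL hM gL gM hLM
  have hbL : ∀ i, b i ∈ L := fun i => by
    rw [hLb]; exact Submodule.subset_span ⟨i, rfl⟩
  have hMT : ∀ x ∈ L, ∀ y ∈ M, x ⬝ᵥ y ∈ T := by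
    intro x hx y hy
    rw [mT, ← w2_mul]
    exact A.mul_mem hy hx
  obtain ⟨k, hk, hkT, hTt⟩ := rank_one hT _ hD (hMT _ (hbL 2) _ (hLM _ (hbL 0) _ (hbL 1)))
  set D := b 2 ⬝ᵥ crossProduct (b 0) (b 1) with hDdef
  have e0 : b 0 ⬝ᵥ crossProduct (b 1) (b 2) = D := by
    simp [hDdef, cross_apply, dotProduct, Fin.sum_univ_three]; ring
  have e1 : b 1 ⬝ᵥ crossProduct (b 0) (b 2) = - D := by
    simp [hDdef, cross_apply, dotProduct, Fin.sum_univ_three]; ring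
  -- scalars
  have hscal : ∀ q : ℚ, q • (1 : Lambda3) ∈ A → ∃ n : ℤ, q = n := by
    intro q hq
    let S : Subalgebra ℤ Lambda3 := subalgebraOfSubring A
    have hS : (Subalgebra.toSubmodule S).FG := hAZ.fg
    have h1 : IsIntegral ℤ (algebraMap ℚ Lambda3 q) :=
      IsIntegral.of_mem_of_fg S hS _ (by rw [Algebra.algebraMap_eq_smul_one]; exact hq)
    have h2 : IsIntegral ℤ q :=
      (isIntegral_algebraMap_iff (ExteriorAlgebra.algebraMap_leftInverse _).injective).1 h1
    obtain ⟨n, hn⟩ := IsIntegrallyClosed.isIntegral_iff.1 h2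
    exact ⟨n, by rw [← hn]; rfl⟩
  refine ⟨fun i => ExteriorAlgebra.ι ℚ (b i), 1, k2, k1, k0, k, hbL,
    fun i => iota_mem_wComp d _ _ (hbd i), hk2, hk1, hk0, hk, ?_, ?_, ?_, ?_⟩
  · obtain ⟨n, hn⟩ := hTt _ (hMT _ (hbL 2) _ hM2)
    rw [dotProduct_smul, smul_eq_mul, ← hDdef] at hn
    exact dvd_aux hk2 hk hD hn
  · obtain ⟨n, hn⟩ := hTt _ (hMT _ (hbL 1) _ hM1)
    rw [dotProduct_smul, smul_eq_mul, e1] at hn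
    refine dvd_aux hk1 hk hD (n := -n) ?_
    push_cast
    linarith
  · obtain ⟨n, hn⟩ := hTt _ (hMT _ (hbL 0) _ hM0)
    rw [dotProduct_smul, smul_eq_mul, e0] at hn
    exact dvd_aux hk0 hk hD hn
  simp only [iota_mul, w2_mul, smul_smul, ← hDdef]
  simp only [← w2.map_smul]
  apply le_antisymm
  · intro a ha
    have ha' : a ∈ A := ha
    set C := AddSubgroup.closure ({1, ExteriorAlgebra.ι ℚ (b 0), ExteriorAlgebra.ι ℚ (b 1),
      ExteriorAlgebra.ι ℚ (b 2), w2 ((k2 : ℚ)⁻¹ • crossProduct (b 0) (b 1)),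
      w2 ((k1 : ℚ)⁻¹ • crossProduct (b 0) (b 2)), w2 ((k0 : ℚ)⁻¹ • crossProduct (b 1) (b 2)),
      ((k : ℚ)⁻¹ * D) • top3} : Set Lambda3) with hC
    have hCs : ∀ z ∈ ({1, ExteriorAlgebra.ι ℚ (b 0), ExteriorAlgebra.ι ℚ (b 1),
      ExteriorAlgebra.ι ℚ (b 2), w2 ((k2 : ℚ)⁻¹ • crossProduct (b 0) (b 1)),
      w2 ((k1 : ℚ)⁻¹ • crossProduct (b 0) (b 2)), w2 ((k0 : ℚ)⁻¹ • crossProduct (b 1) (b 2)),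
      ((k : ℚ)⁻¹ * D) • top3} : Set Lambda3), ∀ n : ℤ, n • z ∈ C := fun z hz n =>
        C.zsmul_mem (AddSubgroup.subset_closure hz) n
    obtain ⟨q, x, y, t, rfl⟩ := decomp a
    have hp : ∀ i, 0 < d i := hpos
    have p0 := hpos 0
    have p1 := hpos 1
    have p2 := hpos 2
    have hle : ∀ j, d j < d 0 + d 1 + d 2 := fun j => by fin_cases j <;> simp <;> omega
    have hev : ∀ j, Even (d 0 + d 1 + d 2 - d j) := by
      intro j
      obtain ⟨a0, ha0⟩ := hodd 0
      obtain ⟨a1, ha1⟩ := hodd 1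
      obtain ⟨a2, ha2⟩ := hodd 2
      rw [Nat.even_iff]
      fin_cases j <;> simp <;> omega
    have hOdd3 : ¬ Even (d 0 + d 1 + d 2) := by
      obtain ⟨a0, ha0⟩ := hodd 0
      obtain ⟨a1, ha1⟩ := hodd 1
      obtain ⟨a2, ha2⟩ := hodd 2
      rw [Nat.even_iff]
      omega
    have hne : ∀ j, ¬ Even (d j) := fun j => Nat.not_even_iff_odd.2 (hodd j)
    have hq : q • (1 : Lambda3) ∈ A := by
      have h := hproj {0} _ ha'
      simp only [map_add, map_smul, proj_one, proj_iota, proj_w2, proj_top,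
        Set.mem_singleton_iff] at h
      have a1 : ∀ i, d i ≠ 0 := fun i => (hpos i).ne'
      have a2 : ∀ i, d 0 + d 1 + d 2 - d i ≠ 0 := fun i => by have := hle i; omega
      have a3 : d 0 + d 1 + d 2 ≠ 0 := by omega
      simp only [a1, a2, a3, if_true, if_false] at h
      simpa [← Pi.zero_def] using h
    have hx : ExteriorAlgebra.ι ℚ x ∈ A := by
      have h := hproj {m | Odd m ∧ m < d 0 + d 1 + d 2} _ ha'
      have a1 : ∀ i, d i ∈ {m | Odd m ∧ m < d 0 + d 1 + d 2} := fun i => ⟨hodd i, hle i⟩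
      have a2 : ∀ i, d 0 + d 1 + d 2 - d i ∉ {m | Odd m ∧ m < d 0 + d 1 + d 2} :=
        fun i hi => Nat.not_even_iff_odd.2 hi.1 (hev i)
      have a3 : d 0 + d 1 + d 2 ∉ {m | Odd m ∧ m < d 0 + d 1 + d 2} := fun hi => lt_irrefl _ hi.2
      have a4 : 0 ∉ {m | Odd m ∧ m < d 0 + d 1 + d 2} := fun hi => by simpa using hi.1
      simp only [map_add, map_smul, proj_one, proj_iota, proj_w2, proj_top,
        a1, a2, a3, a4, if_true, if_false] at h
      simpa [← Pi.zero_def] using h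
    have hy : w2 y ∈ A := by
      have h := hproj {m | Even m ∧ 0 < m} _ ha'
      have a1 : ∀ i, d i ∉ {m | Even m ∧ 0 < m} := fun i hi => hne i hi.1
      have a2 : ∀ i, d 0 + d 1 + d 2 - d i ∈ {m | Even m ∧ 0 < m} :=
        fun i => ⟨hev i, by have := hle i; omega⟩
      have a3 : d 0 + d 1 + d 2 ∉ {m | Even m ∧ 0 < m} := fun hi => hOdd3 hi.1
      have a4 : 0 ∉ {m | Even m ∧ 0 < m} := fun hi => lt_irrefl _ hi.2
      simp only [map_add, map_smul, proj_one, proj_iota, proj_w2, proj_top,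
        a1, a2, a3, a4, if_true, if_false] at h
      simpa [← Pi.zero_def] using h
    have ht : t • top3 ∈ A := by
      have h := A.sub_mem ha' (A.add_mem (A.add_mem hq hx) hy)
      simpa using h
    refine C.add_mem (C.add_mem (C.add_mem ?_ ?_) ?_) ?_
    · obtain ⟨n, rfl⟩ := hscal q hq
      rw [Int.cast_smul_eq_zsmul ℚ]
      exact hCs _ (by simp) n
    · have hx' : x ∈ L := hx
      rw [hLb, Submodule.mem_span_range_iff_exists_fun] at hx'
      obtain ⟨n, rfl⟩ := hx'
      rw [Fin.sum_univ_three, map_add, map_add, map_zsmul, map_zsmul, map_zsmul]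
      exact C.add_mem (C.add_mem (hCs _ (by simp) _) (hCs _ (by simp) _)) (hCs _ (by simp) _)
    · obtain ⟨n0, n1, n2, rfl⟩ := hMy y hy
      rw [map_add, map_add, map_zsmul, map_zsmul, map_zsmul]
      exact C.add_mem (C.add_mem (hCs _ (by simp) _) (hCs _ (by simp) _)) (hCs _ (by simp) _)
    · obtain ⟨n, rfl⟩ := hTt t ht
      rw [mul_smul, Int.cast_smul_eq_zsmul ℚ]
      exact hCs _ (by simp) n
  · rw [AddSubgroup.closure_le]
    intro z hz
    change z ∈ A
    simp only [Set.mem_insert_iff, Set.mem_singleton_iff] at hz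
    rcases hz with rfl | rfl | rfl | rfl | rfl | rfl | rfl | rfl
    · exact A.one_mem
    · exact hbL 0
    · exact hbL 1
    · exact hbL 2
    · exact hM2
    · exact hM1
    · exact hM0
    · exact hkT

end
end

section
/- Let Λ = Λ_ℚ(ℚ³) be the exterior algebra over ℚ on ℚ³, graded by exterior degree, so Λ = Λ⁰ ⊕ Λ¹ ⊕ Λ² ⊕ Λ³. Suppose A ⊆ Λ is a subring that, as an additive group, is generated by a ℚ-basis of Λ consisting of elements each lying in a single exterior-degree component Λ^k. Then there exist b₁, b₂, b₃ ∈ A ∩ Λ¹ and positive integers c₁₂, c₁₃, c₂₃, c₁₂₃ with c₁₂ ∣ c₁₂₃, c₁₃ ∣ c₁₂₃, c₂₃ ∣ c₁₂₃, such that A equals the additive subgroup of Λ generated by {1, b₁, b₂, b₃, (1/c₁₂)·b₁∧b₂, (1/c₁₃)·b₁∧b₃, (1/c₂₃)·b₂∧b₃, (1/c₁₂₃)·b₁∧b₂∧b₃}. -/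
noncomputable section

/-- The exterior-degree-`k` component `Λᵏ` of `Λ_ℚ(ℚ³)`. -/
def extComp (k : ℕ) : Submodule ℚ Lambda3 :=
  LinearMap.range (ExteriorAlgebra.ι ℚ (M := Fin 3 → ℚ)) ^ k


abbrev V3 := Fin 3 → ℚ

lemma exists_lattice_basis {V : Type*} [AddCommGroup V] [Module ℚ V] [Module.Finite ℚ V] {n : ℕ}
    (hn : Module.finrank ℚ V = n)
    (L : Submodule ℤ V) [Module.Finite ℤ L] (h : ∀ v : V, ∃ n : ℕ, 0 < n ∧ n • v ∈ L) :
    ∃ β : Module.Basis (Fin n) ℤ L, LinearIndependent ℚ (fun i => (β i : V)) := by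
  have : Module.IsTorsionFree ℤ V := Module.IsTorsionFree.trans ℚ
  have : Module.IsTorsionFree ℤ L := inferInstance
  let b := Module.finBasis ℤ L
  have hli : LinearIndependent ℚ (fun i => (b i : V)) := by
    rw [← LinearIndependent.iff_fractionRing ℤ ℚ]
    exact b.linearIndependent.map' L.subtype (by simp)
  have hsp : ⊤ ≤ Submodule.span ℚ (Set.range (fun i => (b i : V))) := by
    intro v _
    obtain ⟨n, hn, hv⟩ := h v
    have h1 : (n • v) ∈ Submodule.span ℚ (Set.range (fun i => (b i : V))) := by
      have := b.sum_repr ⟨_, hv⟩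
      have h2 := congrArg (L.subtype) this
      simp only [map_sum, map_smul, Submodule.subtype_apply] at h2
      rw [← h2]
      refine Submodule.sum_mem _ fun i _ => ?_
      rw [← Int.cast_smul_eq_zsmul ℚ]
      exact Submodule.smul_mem _ _ (Submodule.subset_span ⟨i, rfl⟩)
    rw [← Nat.cast_smul_eq_nsmul ℚ] at h1
    exact (Submodule.smul_mem_iff _ (by positivity)).1 h1
  have hc := Module.finrank_eq_card_basis (Module.Basis.mk hli hsp)
  simp only [Fintype.card_fin] at hc
  have hc' : Module.finrank ℤ L = n := by rw [← hc, hn]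
  refine ⟨b.reindex (finCongr hc'), ?_⟩
  simpa [Function.comp_def] using hli.comp (finCongr hc').symm (Equiv.injective _)

open Matrix in
lemma dot3 {R : Type*} [CommRing R] (u w : Fin 3 → R) :
    u ⬝ᵥ w = u 0 * w 0 + u 1 * w 1 + u 2 * w 2 := by
  simp [dotProduct, Fin.sum_univ_three]

/-- Integral combination of three vectors. -/
def comb (x y z : V3) (t : Fin 3 → ℤ) : V3 := t 0 • x + t 1 • y + t 2 • z

open Matrix in
lemma dot_comb (x y z : V3) (g : Fin 3 → ℤ) :
    x ⬝ᵥ comb (y ⨯₃ z) (z ⨯₃ x) (x ⨯₃ y) g = g 0 * (x ⬝ᵥ y ⨯₃ z) ∧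
    y ⬝ᵥ comb (y ⨯₃ z) (z ⨯₃ x) (x ⨯₃ y) g = g 1 * (x ⬝ᵥ y ⨯₃ z) ∧
    z ⬝ᵥ comb (y ⨯₃ z) (z ⨯₃ x) (x ⨯₃ y) g = g 2 * (x ⬝ᵥ y ⨯₃ z) := by
  refine ⟨?_, ?_, ?_⟩ <;>
  · simp only [dot3]
    simp [comb, cross_apply]
    ring

open Matrix in
lemma comb_dot_comb (x y z : V3) (s t : Fin 3 → ℤ) :
    comb x y z s ⬝ᵥ comb (y ⨯₃ z) (z ⨯₃ x) (x ⨯₃ y) t = (s ⬝ᵥ t : ℤ) * (x ⬝ᵥ y ⨯₃ z) := by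
  simp only [dot3]
  simp [comb, cross_apply]
  ring

open Matrix in
lemma comb_cross_comb (x y z : V3) (s t : Fin 3 → ℤ) :
    comb x y z s ⨯₃ comb x y z t = comb (y ⨯₃ z) (z ⨯₃ x) (x ⨯₃ y) (s ⨯₃ t) := by
  ext i
  fin_cases i <;>
  · simp [comb, cross_apply]
    ring

open Matrix in
lemma cross_cross_det (p q r : Fin 3 → ℤ) :
    (r ⨯₃ p) ⨯₃ (p ⨯₃ q) = (p ⬝ᵥ q ⨯₃ r) • p := by
  ext i
  fin_cases i <;>
  · simp only [dot3]
    simp [cross_apply]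
    ring

lemma comb_smul (x y z : V3) (n : ℤ) (t : Fin 3 → ℤ) : comb x y z (n • t) = n • comb x y z t := by
  simp [comb, mul_smul]

open Matrix in
lemma comb_recover (x y z : V3) (p q r : Fin 3 → ℤ) :
    p 0 • comb x y z (q ⨯₃ r) + q 0 • comb x y z (r ⨯₃ p) + r 0 • comb x y z (p ⨯₃ q)
      = (p ⬝ᵥ q ⨯₃ r) • x ∧
    p 1 • comb x y z (q ⨯₃ r) + q 1 • comb x y z (r ⨯₃ p) + r 1 • comb x y z (p ⨯₃ q)
      = (p ⬝ᵥ q ⨯₃ r) • y ∧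
    p 2 • comb x y z (q ⨯₃ r) + q 2 • comb x y z (r ⨯₃ p) + r 2 • comb x y z (p ⨯₃ q)
      = (p ⬝ᵥ q ⨯₃ r) • z := by
  refine ⟨?_, ?_, ?_⟩ <;>
  · simp only [dot3]
    ext i
    simp [comb, cross_apply]
    ring

lemma comb_mem (L : Submodule ℤ V3) {x y z : V3} (hx : x ∈ L) (hy : y ∈ L) (hz : z ∈ L)
    (t : Fin 3 → ℤ) : comb x y z t ∈ L :=
  L.add_mem (L.add_mem (L.smul_mem _ hx) (L.smul_mem _ hy)) (L.smul_mem _ hz)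

lemma basis_le_span {L : Submodule ℤ V3} (β : Module.Basis (Fin 3) ℤ L) :
    L ≤ Submodule.span ℤ (Set.range fun i => (β i : V3)) := by
  intro v hv
  have h2 := congrArg (L.subtype) (β.sum_repr ⟨_, hv⟩)
  simp only [map_sum, map_smul, Submodule.subtype_apply] at h2
  rw [← h2]
  exact Submodule.sum_mem _ fun i _ => Submodule.smul_mem _ _ (Submodule.subset_span ⟨i, rfl⟩)

open Matrix in
lemma core_s1 (L1 L2 : Submodule ℤ V3) (β : Module.Basis (Fin 3) ℤ L1) (γ : Module.Basis (Fin 3) ℤ L2)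
    (hβ : LinearIndependent ℚ (fun i => (β i : V3)))
    (h : ∀ v ∈ L1, ∀ w ∈ L1, v ⨯₃ w ∈ L2) :
    ∃ (b u : Fin 3 → V3) (a : Fin 3 → ℤ), (∀ i, a i ≠ 0) ∧ (∀ i, b i ∈ L1) ∧ (∀ i, u i ∈ L2) ∧
      L1 ≤ Submodule.span ℤ (Set.range b) ∧ L2 ≤ Submodule.span ℤ (Set.range u) ∧
      b 1 ⨯₃ b 2 = a 0 • u 0 ∧ b 2 ⨯₃ b 0 = a 1 • u 1 ∧ b 0 ⨯₃ b 1 = a 2 • u 2 ∧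
      b 0 ⬝ᵥ b 1 ⨯₃ b 2 ≠ 0 := by
  have hdet : (β 0 : V3) ⬝ᵥ (β 1 : V3) ⨯₃ (β 2 : V3) ≠ 0 := by
    rw [triple_product_eq_det]
    have h1 : (Matrix.of (fun i => (β i : V3))) = ![(β 0 : V3), (β 1 : V3), (β 2 : V3)] := by
      ext i j; fin_cases i <;> rfl
    have h2 : LinearIndependent ℚ (Matrix.of (fun i => (β i : V3))).row := hβ
    rw [Matrix.linearIndependent_rows_iff_isUnit, Matrix.isUnit_iff_isUnit_det, h1] at h2
    exact h2.ne_zero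
  have hL1 := basis_le_span β
  obtain ⟨x, hx⟩ : ∃ x, x = (β 0 : V3) := ⟨_, rfl⟩
  obtain ⟨y, hy⟩ : ∃ x, x = (β 1 : V3) := ⟨_, rfl⟩
  obtain ⟨z, hz⟩ : ∃ x, x = (β 2 : V3) := ⟨_, rfl⟩
  have hr : (fun i => (β i : V3)) = ![x, y, z] := by
    ext i j; fin_cases i <;> simp [hx, hy, hz]
  have hxL : x ∈ L1 := hx ▸ (β 0).2
  have hyL : y ∈ L1 := hy ▸ (β 1).2
  have hzL : z ∈ L1 := hz ▸ (β 2).2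
  rw [hr] at hL1
  rw [← hx, ← hy, ← hz] at hdet
  clear hr hx hy hz hβ β
  let m : Fin 3 → L2 := ![⟨y ⨯₃ z, h _ hyL _ hzL⟩, ⟨z ⨯₃ x, h _ hzL _ hxL⟩, ⟨x ⨯₃ y, h _ hxL _ hyL⟩]
  have hcomb : ∀ g : Fin 3 → ℤ, ((∑ i, g i • m i : L2) : V3) =
      comb (y ⨯₃ z) (z ⨯₃ x) (x ⨯₃ y) g := by
    intro g
    simp [Fin.sum_univ_three, m, comb]
  have hm : LinearIndependent ℤ m := by
    rw [Fintype.linearIndependent_iff]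
    intro g hg
    have h2 := hcomb g
    rw [hg] at h2
    have := dot_comb x y z g
    rw [← h2] at this
    simp [hdet] at this
    obtain ⟨h0, h1, h2⟩ := this
    intro i
    fin_cases i
    · exact h0
    · exact h1
    · exact h2
  let N := Submodule.span ℤ (Set.range m)
  let mB : Module.Basis (Fin 3) ℤ N := Module.Basis.span hm
  have hmB : ∀ i, (mB i : L2) = m i := fun i =>
    congrArg Subtype.val (Module.Basis.span_apply hm i)
  obtain ⟨u, a, ab, hab⟩ := Submodule.exists_smith_normal_form_of_rank_eq (N := N) γ (by
    rw [Module.finrank_eq_card_basis γ, Module.finrank_eq_card_basis mB])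
  have ha : ∀ i, a i ≠ 0 := by
    intro i hi
    have := hab i
    rw [hi, zero_smul] at this
    exact ab.ne_zero i (Subtype.ext this)
  let P := mB.toMatrix ab
  have hPu : IsUnit P.det := by
    rw [← Matrix.isUnit_iff_isUnit_det]
    exact IsUnit.of_mul_eq_one _ (mB.toMatrix_mul_toMatrix_flip ab)
  have hPv : ∀ i, comb (y ⨯₃ z) (z ⨯₃ x) (x ⨯₃ y) (fun j => P j i) = a i • (u i : V3) := by
    intro i
    rw [← hcomb]
    have h1 := congrArg (fun t : N => (t : L2)) (mB.sum_toMatrix_smul_self ab i)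
    simp only [Submodule.coe_sum, Submodule.coe_smul, hmB] at h1
    rw [hab i] at h1
    exact congrArg (fun t : L2 => (t : V3)) h1
  let p : Fin 3 → ℤ := fun j => P j 0
  let q : Fin 3 → ℤ := fun j => P j 1
  let r : Fin 3 → ℤ := fun j => P j 2
  have hp : comb (y ⨯₃ z) (z ⨯₃ x) (x ⨯₃ y) p = a 0 • (u 0 : V3) := hPv 0
  have hq : comb (y ⨯₃ z) (z ⨯₃ x) (x ⨯₃ y) q = a 1 • (u 1 : V3) := hPv 1
  have hr : comb (y ⨯₃ z) (z ⨯₃ x) (x ⨯₃ y) r = a 2 • (u 2 : V3) := hPv 2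
  have hD : IsUnit (p ⬝ᵥ q ⨯₃ r) := by
    rw [Matrix.det_fin_three] at hPu
    convert hPu using 1
    simp only [dot3]
    simp [cross_apply, p, q, r]
    ring
  clear_value p q r
  have e1 : q ⬝ᵥ r ⨯₃ p = p ⬝ᵥ q ⨯₃ r := (triple_product_permutation p q r).symm
  have e2 : r ⬝ᵥ p ⨯₃ q = p ⬝ᵥ q ⨯₃ r := triple_product_permutation r p q
  have hrec := comb_recover x y z p q r
  have hDD := Int.isUnit_mul_self hD
  have cr0 : comb x y z (r ⨯₃ p) ⨯₃ comb x y z (p ⨯₃ q) = ((p ⬝ᵥ q ⨯₃ r) * a 0) • (u 0 : V3) := by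
    rw [comb_cross_comb, cross_cross_det, comb_smul, hp, mul_smul]
  have cr1 : comb x y z (p ⨯₃ q) ⨯₃ comb x y z (q ⨯₃ r) = ((p ⬝ᵥ q ⨯₃ r) * a 1) • (u 1 : V3) := by
    rw [comb_cross_comb, cross_cross_det, comb_smul, hq, mul_smul, e1]
  have cr2 : comb x y z (q ⨯₃ r) ⨯₃ comb x y z (r ⨯₃ p) = ((p ⬝ᵥ q ⨯₃ r) * a 2) • (u 2 : V3) := by
    rw [comb_cross_comb, cross_cross_det, comb_smul, hr, mul_smul, e2]
  have hne : comb x y z (q ⨯₃ r) ⬝ᵥ (comb x y z (r ⨯₃ p) ⨯₃ comb x y z (p ⨯₃ q)) ≠ 0 := by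
    have : comb x y z (q ⨯₃ r) ⬝ᵥ (comb x y z (r ⨯₃ p) ⨯₃ comb x y z (p ⨯₃ q)) =
       ((p ⬝ᵥ q ⨯₃ r) * (p ⬝ᵥ q ⨯₃ r) : ℤ) * (x ⬝ᵥ y ⨯₃ z) := by
      rw [comb_cross_comb, cross_cross_det, comb_dot_comb, dotProduct_smul, smul_eq_mul,
        dotProduct_comm (q ⨯₃ r) p]
    rw [this, hDD]
    simpa using hdet
  refine ⟨![comb x y z (q ⨯₃ r), comb x y z (r ⨯₃ p), comb x y z (p ⨯₃ q)], fun i => (u i : V3),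
    fun i => (p ⬝ᵥ q ⨯₃ r) * a i, fun i => mul_ne_zero hD.ne_zero (ha i), ?_, fun i => (u i).2, ?_,
    basis_le_span u, cr0, cr1, cr2, hne⟩
  · intro i
    fin_cases i <;> exact comb_mem L1 hxL hyL hzL _
  · refine hL1.trans (Submodule.span_le.2 ?_)
    generalize comb x y z (q ⨯₃ r) = b0 at *
    generalize comb x y z (r ⨯₃ p) = b1 at *
    generalize comb x y z (p ⨯₃ q) = b2 at *
    generalize p ⬝ᵥ q ⨯₃ r = D at *
    have key : ∀ (k l n : ℤ) (w : V3), k • b0 + l • b1 + n • b2 = D • w →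
        w ∈ Submodule.span ℤ (Set.range ![b0, b1, b2]) := by
      intro k l n w hw
      have : w = D • (k • b0 + l • b1 + n • b2) := by
        rw [hw, smul_smul, hDD, one_smul]
      rw [this]
      have hi : ∀ i, ![b0, b1, b2] i ∈ Submodule.span ℤ (Set.range ![b0, b1, b2]) :=
        fun i => Submodule.subset_span ⟨i, rfl⟩
      exact Submodule.smul_mem _ _ (comb_mem _ (hi 0) (hi 1) (hi 2) ![k, l, n])
    rintro _ ⟨i, rfl⟩
    fin_cases i
    · exact key _ _ _ _ hrec.1
    · exact key _ _ _ _ hrec.2.1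
    · exact key _ _ _ _ hrec.2.2

abbrev iota1 : V3 →ₗ[ℚ] Lambda3 := ExteriorAlgebra.ι ℚ

/-- standard generators -/
def ee (i : Fin 3) : Lambda3 := iota1 (Pi.single i 1)

lemma iota1_eq (v : V3) : iota1 v = v 0 • ee 0 + v 1 • ee 1 + v 2 • ee 2 := by
  have : v = v 0 • Pi.single 0 1 + v 1 • Pi.single 1 1 + v 2 • Pi.single 2 1 := by
    ext i; fin_cases i <;> simp
  conv_lhs => rw [this]
  simp only [map_add, map_smul, ee]

lemma ee_sq (i : Fin 3) : ee i * ee i = 0 := ExteriorAlgebra.ι_sq_zero _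

lemma ee_swap (i j : Fin 3) : ee i * ee j = - (ee j * ee i) :=
  eq_neg_of_add_eq_zero_left (ExteriorAlgebra.ι_add_mul_swap _ _)

/-- the degree two part -/
def phi2 : V3 →ₗ[ℚ] Lambda3 :=
  (LinearMap.proj 0).smulRight (ee 1 * ee 2) + (LinearMap.proj 1).smulRight (ee 2 * ee 0) +
    (LinearMap.proj 2).smulRight (ee 0 * ee 1)

lemma phi2_eq (w : V3) :
    phi2 w = w 0 • (ee 1 * ee 2) + w 1 • (ee 2 * ee 0) + w 2 • (ee 0 * ee 1) := by
  simp [phi2]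

/-- the degree three part -/
def phi3 : ℚ →ₗ[ℚ] Lambda3 := LinearMap.id.smulRight (ee 0 * (ee 1 * ee 2))

lemma phi3_eq (t : ℚ) : phi3 t = t • (ee 0 * (ee 1 * ee 2)) := by
  simp [phi3]

/-- the degree zero part -/
def phi0 : ℚ →ₗ[ℚ] Lambda3 := LinearMap.id.smulRight 1

lemma phi0_eq (t : ℚ) : phi0 t = t • (1 : Lambda3) := by
  simp [phi0]

open Matrix in
lemma iota1_mul_iota1 (v w : V3) : iota1 v * iota1 w = phi2 (v ⨯₃ w) := by
  rw [iota1_eq, iota1_eq, phi2_eq]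
  simp only [mul_add, add_mul, smul_mul_assoc, mul_smul_comm, ee_sq, ee_swap 1 0, ee_swap 2 1,
    ee_swap 0 2]
  simp [cross_apply]
  module

lemma ee_mid (i j : Fin 3) : ee i * (ee j * ee i) = 0 := by
  rw [ee_swap j i, mul_neg, ← mul_assoc, ee_sq, zero_mul, neg_zero]

lemma ee_left (i j : Fin 3) : ee i * (ee i * ee j) = 0 := by
  rw [← mul_assoc, ee_sq, zero_mul]

lemma ee_120 : ee 1 * (ee 2 * ee 0) = ee 0 * (ee 1 * ee 2) := by
  rw [ee_swap 2 0, mul_neg, ← mul_assoc, ee_swap 1 0, neg_mul, neg_neg, mul_assoc]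

lemma ee_201 : ee 2 * (ee 0 * ee 1) = ee 0 * (ee 1 * ee 2) := by
  rw [ee_swap 1 2, ← mul_assoc, ee_swap 2 0, neg_mul, mul_neg, mul_assoc]

open Matrix in
lemma iota1_mul_phi2 (v w : V3) : iota1 v * phi2 w = phi3 (v ⬝ᵥ w) := by
  rw [iota1_eq, phi2_eq, phi3_eq, dot3]
  simp only [mul_add, add_mul, smul_mul_assoc, mul_smul_comm, ee_mid, ee_left, ee_120, ee_201]
  module

open Matrix in
lemma phi2_mul_iota1 (v w : V3) : phi2 w * iota1 v = phi3 (v ⬝ᵥ w) := by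
  have h : ∀ i j k : Fin 3, ee i * ee j * ee k = ee k * (ee i * ee j) := by
    intro i j k
    rw [mul_assoc, ee_swap j k, mul_neg, ← mul_assoc, ee_swap i k, neg_mul, neg_neg, mul_assoc]
  rw [← iota1_mul_phi2, iota1_eq, phi2_eq]
  simp only [mul_add, add_mul, smul_mul_assoc, mul_smul_comm, h]
  module

lemma phi3_mul_iota1 (v : V3) (t : ℚ) : phi3 t * iota1 v = 0 := by
  have h0 : ee 0 * (ee 1 * ee 2) * ee 0 = 0 := by
    rw [mul_assoc, mul_assoc, ee_120, ← mul_assoc (ee 0) (ee 0), ee_sq, zero_mul]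
  have h1 : ee 0 * (ee 1 * ee 2) * ee 1 = 0 := by
    rw [mul_assoc, mul_assoc, ee_mid, mul_zero]
  have h2 : ee 0 * (ee 1 * ee 2) * ee 2 = 0 := by
    rw [mul_assoc, mul_assoc, ee_sq, mul_zero, mul_zero]
  rw [iota1_eq, phi3_eq]
  simp [mul_add, h0, h1, h2]

lemma phi3_inj : Function.Injective phi3 := by
  have hne : ee 0 * (ee 1 * ee 2) ≠ 0 := by
    intro h
    let f : ∀ i, V3 [⋀^Fin i]→ₗ[ℚ] ℚ := fun i =>
      if hi : i = 3 then by subst hi; exact Matrix.detRowAlternating else 0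
    have h1 := ExteriorAlgebra.liftAlternating_apply_ιMulti (R := ℚ) f
      (fun i : Fin 3 => (Pi.single i 1 : V3))
    have h2 : ExteriorAlgebra.ιMulti ℚ 3 (fun i : Fin 3 => (Pi.single i 1 : V3)) =
        ee 0 * (ee 1 * ee 2) := by
      simp [ExteriorAlgebra.ιMulti_apply, ee]
      rfl
    rw [h2, h, map_zero] at h1
    have h3 : f 3 = Matrix.detRowAlternating := by simp [f]
    rw [h3] at h1
    have h4 : (fun i : Fin 3 => (Pi.single i 1 : V3)) = (1 : Matrix (Fin 3) (Fin 3) ℚ) := by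
      ext i j; simp [Matrix.one_apply, Pi.single_apply, eq_comm]
    rw [h4] at h1
    change 0 = Matrix.det 1 at h1
    simp at h1
  intro a b h
  rw [phi3_eq, phi3_eq] at h
  exact smul_left_injective ℚ hne h

lemma phi2_inj : Function.Injective phi2 := by
  rw [← LinearMap.ker_eq_bot, LinearMap.ker_eq_bot']
  intro w hw
  ext i
  have := iota1_mul_phi2 (Pi.single i 1) w
  rw [hw, mul_zero, ← map_zero phi3] at this
  simpa using (phi3_inj this).symm

lemma iota1_inj : Function.Injective iota1 := ExteriorAlgebra.ι_leftInverse.injective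

lemma phi0_inj : Function.Injective phi0 := by
  intro a b h
  rw [phi0_eq, phi0_eq] at h
  exact smul_left_injective ℚ one_ne_zero h

lemma mem_ext1 {x : Lambda3} (h : x ∈ extComp 1) : ∃ v, x = iota1 v := by
  rw [extComp, pow_one] at h
  obtain ⟨v, rfl⟩ := h
  exact ⟨v, rfl⟩

lemma extComp_succ (k : ℕ) : extComp (k+1) = extComp k * LinearMap.range iota1 := by
  rw [extComp, extComp, pow_succ]

lemma ext2_le : extComp 2 ≤ LinearMap.range phi2 := by
  rw [extComp_succ, Submodule.mul_le]
  rintro m hm _ ⟨w, rfl⟩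
  obtain ⟨v, rfl⟩ := mem_ext1 hm
  exact ⟨_, (iota1_mul_iota1 v w).symm⟩

lemma ext3_le : extComp 3 ≤ LinearMap.range phi3 := by
  rw [extComp_succ, Submodule.mul_le]
  rintro m hm _ ⟨w, rfl⟩
  obtain ⟨v, rfl⟩ := ext2_le hm
  exact ⟨_, (phi2_mul_iota1 w v).symm⟩

lemma ext4_le (k : ℕ) : extComp (k + 4) = ⊥ := by
  induction k with
  | zero =>
    rw [zero_add, extComp_succ, eq_bot_iff, Submodule.mul_le]
    rintro m hm _ ⟨w, rfl⟩
    obtain ⟨v, rfl⟩ := ext3_le hm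
    rw [phi3_mul_iota1]; simp
  | succ k ih => rw [add_right_comm, extComp_succ, ih, Submodule.bot_mul]

/-- homogeneous elements -/
lemma homog {x : Lambda3} {k : ℕ} (h : x ∈ extComp k) :
    (∃ q, x = phi0 q) ∨ (∃ v, x = iota1 v) ∨ (∃ w, x = phi2 w) ∨ (∃ t, x = phi3 t) := by
  match k with
  | 0 =>
    left
    rw [extComp, pow_zero, Submodule.mem_one] at h
    obtain ⟨q, rfl⟩ := h
    exact ⟨q, by rw [phi0_eq, Algebra.algebraMap_eq_smul_one]⟩
  | 1 => exact .inr (.inl (mem_ext1 h))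
  | 2 =>
    obtain ⟨w, rfl⟩ := ext2_le h
    exact .inr (.inr (.inl ⟨w, rfl⟩))
  | 3 =>
    obtain ⟨w, rfl⟩ := ext3_le h
    exact .inr (.inr (.inr ⟨w, rfl⟩))
  | k + 4 =>
    rw [ext4_le, Submodule.mem_bot] at h
    exact .inl ⟨0, by simp [h]⟩

lemma decompose (S : AddSubgroup Lambda3) (s : Set Lambda3) (hs : ∀ x ∈ s, ∃ k, x ∈ extComp k)
    (hS : S = AddSubgroup.closure s) (x : Lambda3) (hx : x ∈ S) :
    ∃ q v w t, x = phi0 q + iota1 v + phi2 w + phi3 t ∧ phi0 q ∈ S ∧ iota1 v ∈ S ∧ phi2 w ∈ S ∧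
      phi3 t ∈ S := by
  have hx' := hx
  rw [hS] at hx'
  induction hx' using AddSubgroup.closure_induction with
  | mem x hxs =>
    obtain ⟨k, hk⟩ := hs x hxs
    obtain ⟨q, rfl⟩ | ⟨q, rfl⟩ | ⟨q, rfl⟩ | ⟨q, rfl⟩ := homog hk
    · exact ⟨q, 0, 0, 0, by simp, hx, by simp [S.zero_mem], by simp [S.zero_mem], by simp [S.zero_mem]⟩
    · exact ⟨0, q, 0, 0, by simp, by simp [S.zero_mem], hx, by simp [S.zero_mem], by simp [S.zero_mem]⟩
    · exact ⟨0, 0, q, 0, by simp, by simp [S.zero_mem], by simp [S.zero_mem], hx, by simp [S.zero_mem]⟩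
    · exact ⟨0, 0, 0, q, by simp, by simp [S.zero_mem], by simp [S.zero_mem], by simp [S.zero_mem], hx⟩
  | zero =>
    exact ⟨0, 0, 0, 0, by simp, by simp [S.zero_mem], by simp [S.zero_mem], by simp [S.zero_mem],
      by simp [S.zero_mem]⟩
  | add x y hx1 hy1 ihx ihy =>
    obtain ⟨q, v, w, t, rfl, h0, h1, h2, h3⟩ := ihx (hS ▸ hx1)
    obtain ⟨q', v', w', t', rfl, h0', h1', h2', h3'⟩ := ihy (hS ▸ hy1)
    refine ⟨q + q', v + v', w + w', t + t', ?_, ?_, ?_, ?_, ?_⟩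
    · simp only [map_add]; abel
    all_goals rw [map_add]; exact S.add_mem ‹_› ‹_›
  | neg x hx1 ihx =>
    obtain ⟨q, v, w, t, rfl, h0, h1, h2, h3⟩ := ihx (hS ▸ hx1)
    refine ⟨-q, -v, -w, -t, ?_, ?_, ?_, ?_, ?_⟩
    · simp only [map_neg]; abel
    all_goals rw [map_neg]; exact S.neg_mem ‹_›

/-- `A` contains a multiple of everything. -/
lemma exists_mul_mem (S : AddSubgroup Lambda3) (s : Set Lambda3) (hspan : Submodule.span ℚ s = ⊤)
    (hS : S = AddSubgroup.closure s) (x : Lambda3) : ∃ n : ℕ, 0 < n ∧ n • x ∈ S := by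
  have hx : x ∈ Submodule.span ℚ s := hspan ▸ Submodule.mem_top
  induction hx using Submodule.span_induction with
  | mem x h => exact ⟨1, one_pos, by rw [one_smul, hS]; exact AddSubgroup.subset_closure h⟩
  | zero => exact ⟨1, one_pos, by simp [S.zero_mem]⟩
  | add x y _ _ hx hy =>
    obtain ⟨n, hn, hx⟩ := hx
    obtain ⟨m, hm, hy⟩ := hy
    refine ⟨n * m, Nat.mul_pos hn hm, ?_⟩
    rw [smul_add]
    refine S.add_mem ?_ ?_
    · rw [mul_comm, mul_smul]; exact S.nsmul_mem hx _
    · rw [mul_smul]; exact S.nsmul_mem hy _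
  | smul a x _ hx =>
    obtain ⟨n, hn, hx⟩ := hx
    refine ⟨n * a.den, Nat.mul_pos hn a.den_pos, ?_⟩
    have : (n * a.den) • a • x = a.num • (n • x) := by
      rw [← Int.cast_smul_eq_zsmul ℚ, ← Nat.cast_smul_eq_nsmul ℚ, ← Nat.cast_smul_eq_nsmul ℚ,
        smul_smul, smul_smul]
      congr 1
      push_cast
      rw [mul_assoc, mul_comm (a.den : ℚ), Rat.mul_den_eq_num, mul_comm]
    rw [this]
    exact S.zsmul_mem hx _

/-- pulled-back lattice -/
def pull {V : Type*} [AddCommGroup V] [Module ℚ V] (f : V →ₗ[ℚ] Lambda3) (S : AddSubgroup Lambda3) :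
    Submodule ℤ V := AddSubgroup.toIntSubmodule (S.comap f.toAddMonoidHom)

lemma mem_pull {V : Type*} [AddCommGroup V] [Module ℚ V] (f : V →ₗ[ℚ] Lambda3)
    (S : AddSubgroup Lambda3) (v : V) : v ∈ pull f S ↔ f v ∈ S := Iff.rfl

lemma pull_basis {V : Type*} [AddCommGroup V] [Module ℚ V] [Module.Finite ℚ V] {n : ℕ}
    (hn : Module.finrank ℚ V = n) (f : V →ₗ[ℚ] Lambda3)
    (hf : Function.Injective f) (S : AddSubgroup Lambda3) (s : Set Lambda3)
    (hfin : s.Finite) (hspan : Submodule.span ℚ s = ⊤)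
    (hS : S = AddSubgroup.closure s) :
    ∃ β : Module.Basis (Fin n) ℤ (pull f S), LinearIndependent ℚ (fun i => (β i : V)) := by
  have hfg : (AddSubgroup.toIntSubmodule S).FG := by
    refine ⟨hfin.toFinset, ?_⟩
    rw [hfin.coe_toFinset, hS, AddSubgroup.toIntSubmodule_closure]
  have : Module.Finite ℤ (AddSubgroup.toIntSubmodule S) := Module.Finite.iff_fg.2 hfg
  let g : pull f S →ₗ[ℤ] AddSubgroup.toIntSubmodule S :=
    (f.toAddMonoidHom.toIntLinearMap).restrict (fun x hx => hx)
  have hg : Function.Injective g := by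
    intro a b hab
    exact Subtype.ext (hf (congrArg Subtype.val hab))
  have : Module.Finite ℤ (pull f S) := Module.Finite.of_injective g hg
  refine exists_lattice_basis hn _ fun v => ?_
  obtain ⟨n, hn, h⟩ := exists_mul_mem S s hspan hS (f v)
  exact ⟨n, hn, by rw [mem_pull, map_nsmul]; exact h⟩

lemma pull_gen (f : ℚ →ₗ[ℚ] Lambda3)
    (hf : Function.Injective f) (S : AddSubgroup Lambda3) (s : Set Lambda3)
    (hfin : s.Finite) (hspan : Submodule.span ℚ s = ⊤)
    (hS : S = AddSubgroup.closure s) :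
    ∃ g : ℚ, g ≠ 0 ∧ f g ∈ S ∧ ∀ t, f t ∈ S → ∃ n : ℤ, t = n * g := by
  obtain ⟨β, hβ⟩ := pull_basis (n := 1) (by simp) f hf S s hfin hspan hS
  refine ⟨β 0, hβ.ne_zero 0, (β 0).2, fun t ht => ?_⟩
  have h2 := congrArg (Submodule.subtype _) (β.sum_repr ⟨t, ht⟩)
  refine ⟨β.repr ⟨t, ht⟩ 0, ?_⟩
  simpa using h2.symm

lemma finite_of_li (s : Set Lambda3) (hs : LinearIndependent ℚ ((↑) : s → Lambda3))
    (hspan : Submodule.span ℚ s = ⊤) (hh : ∀ x ∈ s, ∃ k, x ∈ extComp k) : s.Finite := by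
  let Φ : (ℚ × V3 × V3 × ℚ) →ₗ[ℚ] Lambda3 := phi0.coprod (iota1.coprod (phi2.coprod phi3))
  have hsur : Function.Surjective Φ := by
    rw [← LinearMap.range_eq_top, eq_top_iff, ← hspan, Submodule.span_le]
    intro x hx
    obtain ⟨k, hk⟩ := hh x hx
    obtain ⟨q, rfl⟩ | ⟨q, rfl⟩ | ⟨q, rfl⟩ | ⟨q, rfl⟩ := homog hk
    · exact ⟨(q, 0, 0, 0), by simp [Φ]⟩
    · exact ⟨(0, q, 0, 0), by simp [Φ]⟩
    · exact ⟨(0, 0, q, 0), by simp [Φ]⟩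
    · exact ⟨(0, 0, 0, q), by simp [Φ]⟩
  have : Module.Finite ℚ Lambda3 := Module.Finite.of_surjective Φ hsur
  exact hs.setFinite

lemma sign_aux_s1 (a : ℤ) (ha : a ≠ 0) : ∃ σ : ℤ, σ * σ = 1 ∧
    ∀ X : Lambda3, ((a.natAbs : ℚ)⁻¹) • (a • X) = σ • X := by
  have ha' : (a : ℚ) ≠ 0 := by exact_mod_cast ha
  rcases Int.natAbs_eq a with h | h
  · refine ⟨1, by norm_num, fun X => ?_⟩
    have h' : (a : ℚ) = (a.natAbs : ℚ) := by
      rw [← Int.cast_natCast, ← h]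
    rw [← Int.cast_smul_eq_zsmul ℚ, smul_smul, ← h', inv_mul_cancel₀ ha', one_smul, one_smul]
  · refine ⟨-1, by norm_num, fun X => ?_⟩
    have h' : (a.natAbs : ℚ) = -(a : ℚ) := by
      have : (a.natAbs : ℤ) = -a := by omega
      rw [← Int.cast_natCast, this, Int.cast_neg]
    rw [← Int.cast_smul_eq_zsmul ℚ, smul_smul, h', inv_neg, neg_mul, inv_mul_cancel₀ ha']
    simp

lemma sign_closure {C : AddSubgroup Lambda3} {σ : ℤ} (h : σ * σ = 1) {X : Lambda3} (hX : σ • X ∈ C) :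
    X ∈ C := by
  have := C.zsmul_mem hX σ
  rwa [smul_smul, h, one_smul] at this

lemma span_aux {V : Type*} [AddCommGroup V] [Module ℚ V] (f : V →ₗ[ℚ] Lambda3)
    (C : AddSubgroup Lambda3) (b : Fin 3 → V) (h : ∀ i, f (b i) ∈ C) {v : V}
    (hv : v ∈ Submodule.span ℤ (Set.range b)) : f v ∈ C := by
  have : Submodule.span ℤ (Set.range b) ≤ pull f C := by
    rw [Submodule.span_le]
    rintro _ ⟨i, rfl⟩
    exact h i
  exact this hv


/-- Any order in the exterior algebra `Λ_ℚ(ℚ³)`, graded by exterior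
degree, is a weighted sphere-product ring with generators `b₁, b₂, b₃ ∈ A ∩ Λ¹`. -/
theorem stmt1 (A : Subring Lambda3)
    (hA : ∃ s : Set Lambda3,
      LinearIndependent ℚ ((↑) : s → Lambda3) ∧
      Submodule.span ℚ s = ⊤ ∧
      (∀ x ∈ s, ∃ k : ℕ, x ∈ extComp k) ∧
      A.toAddSubgroup = AddSubgroup.closure s) :
    ∃ (b : Fin 3 → Lambda3) (c12 c13 c23 c123 : ℕ),
      (∀ i, b i ∈ A) ∧
      (∀ i, b i ∈ extComp 1) ∧
      0 < c12 ∧ 0 < c13 ∧ 0 < c23 ∧ 0 < c123 ∧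
      c12 ∣ c123 ∧ c13 ∣ c123 ∧ c23 ∣ c123 ∧
      A.toAddSubgroup = AddSubgroup.closure
        ({1, b 0, b 1, b 2,
          (c12 : ℚ)⁻¹ • (b 0 * b 1), (c13 : ℚ)⁻¹ • (b 0 * b 2),
          (c23 : ℚ)⁻¹ • (b 1 * b 2),
          (c123 : ℚ)⁻¹ • (b 0 * b 1 * b 2)} : Set Lambda3) := by
  obtain ⟨s, hli, hspan, hh, hS⟩ := hA
  have hfin := finite_of_li s hli hspan hh
  obtain ⟨S, hSA⟩ : ∃ S, S = A.toAddSubgroup := ⟨_, rfl⟩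
  have hmem : ∀ x, x ∈ S ↔ x ∈ A := fun x => by rw [hSA]; rfl
  rw [← hSA] at hS ⊢
  have h3 : Module.finrank ℚ V3 = 3 := by simp
  obtain ⟨β, hβ⟩ := pull_basis h3 iota1 iota1_inj S s hfin hspan hS
  obtain ⟨γ, -⟩ := pull_basis h3 phi2 phi2_inj S s hfin hspan hS
  obtain ⟨g, hg0, hgS, hg⟩ := pull_gen phi3 phi3_inj S s hfin hspan hS
  obtain ⟨q, hq0, hqS, hq⟩ := pull_gen phi0 phi0_inj S s hfin hspan hS
  obtain ⟨b, u, a, ha, hb, hu, hL1, hL2, c0, c1, c2, hne⟩ := core_s1 (pull iota1 S) (pull phi2 S) β γ hβ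
    (by
      intro v hv w hw
      rw [mem_pull, hmem] at *
      rw [← iota1_mul_iota1]
      exact A.mul_mem hv hw)
  clear hβ β γ
  simp only [mem_pull] at hb hu
  -- degree zero
  have hq1 : ∃ n : ℤ, q = n := by
    obtain ⟨n, hn⟩ := hq (q * q) (by
      have : phi0 (q * q) = phi0 q * phi0 q := by simp [phi0_eq, mul_smul]
      rw [this, hmem]
      exact A.mul_mem ((hmem _).1 hqS) ((hmem _).1 hqS))
    exact ⟨n, mul_right_cancel₀ hq0 hn⟩
  obtain ⟨nq, hnq⟩ := hq1
  -- degree three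
  have hdot : ∀ i, phi3 (b i ⬝ᵥ u i) ∈ S := by
    intro i
    rw [← iota1_mul_phi2, hmem]
    exact A.mul_mem ((hmem _).1 (hb i)) ((hmem _).1 (hu i))
  choose m hm using fun i => hg _ (hdot i)
  have d0 : b 0 ⬝ᵥ crossProduct (b 1) (b 2) = (a 0 * m 0 : ℤ) * g := by
    rw [c0, dotProduct_smul, hm, zsmul_eq_mul]; push_cast; ring
  have d1 : b 0 ⬝ᵥ crossProduct (b 1) (b 2) = (a 1 * m 1 : ℤ) * g := by
    rw [triple_product_permutation, c1, dotProduct_smul, hm, zsmul_eq_mul]; push_cast; ring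
  have d2 : b 0 ⬝ᵥ crossProduct (b 1) (b 2) = (a 2 * m 2 : ℤ) * g := by
    rw [triple_product_permutation, triple_product_permutation, c2, dotProduct_smul, hm,
      zsmul_eq_mul]; push_cast; ring
  have hk1 : a 1 * m 1 = a 0 * m 0 := by
    have := mul_right_cancel₀ hg0 (d1.symm.trans d0); exact_mod_cast this
  have hk2 : a 2 * m 2 = a 0 * m 0 := by
    have := mul_right_cancel₀ hg0 (d2.symm.trans d0); exact_mod_cast this
  have hk : a 0 * m 0 ≠ 0 := by
    intro h
    rw [h] at d0
    simp [d0] at hne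
  have p12 : iota1 (b 0) * iota1 (b 1) = a 2 • phi2 (u 2) := by
    rw [iota1_mul_iota1, c2, map_zsmul]
  have p13 : iota1 (b 0) * iota1 (b 2) = (-a 1) • phi2 (u 1) := by
    rw [iota1_mul_iota1, ← cross_anticomm, c1, map_neg, map_zsmul, neg_smul]
  have p23 : iota1 (b 1) * iota1 (b 2) = a 0 • phi2 (u 0) := by
    rw [iota1_mul_iota1, c0, map_zsmul]
  have p123 : iota1 (b 0) * iota1 (b 1) * iota1 (b 2) = (a 0 * m 0) • phi3 g := by
    rw [mul_assoc, iota1_mul_iota1, iota1_mul_phi2, d0, ← map_zsmul, zsmul_eq_mul]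
  obtain ⟨s2, hs2, e2⟩ := sign_aux_s1 (a 2) (ha 2)
  obtain ⟨s1, hs1, e1⟩ := sign_aux_s1 (-a 1) (neg_ne_zero.2 (ha 1))
  obtain ⟨s0, hs0, e0⟩ := sign_aux_s1 (a 0) (ha 0)
  obtain ⟨s3, hs3, e3⟩ := sign_aux_s1 (a 0 * m 0) hk
  refine ⟨fun i => iota1 (b i), (a 2).natAbs, (-a 1).natAbs, (a 0).natAbs, (a 0 * m 0).natAbs,
    fun i => (hmem _).1 (hb i), ?_, Int.natAbs_pos.2 (ha 2),
    Int.natAbs_pos.2 (neg_ne_zero.2 (ha 1)), Int.natAbs_pos.2 (ha 0), Int.natAbs_pos.2 hk,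
    ?_, ?_, ?_, ?_⟩
  · intro i
    rw [extComp, pow_one]
    exact ⟨b i, rfl⟩
  · rw [Int.natAbs_dvd_natAbs, ← hk2]; exact dvd_mul_right _ _
  · rw [Int.natAbs_dvd_natAbs, ← hk1, neg_dvd]; exact dvd_mul_right _ _
  · rw [Int.natAbs_dvd_natAbs]; exact dvd_mul_right _ _
  · simp only [p123, e3]
    simp only [p12, p13, p23, e0, e1, e2]
    apply le_antisymm
    · intro x hx
      obtain ⟨q', v, w, t, rfl, hq', hv, hw, ht⟩ := decompose S s hh hS x hx
      refine add_mem (add_mem (add_mem ?_ ?_) ?_) ?_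
      · obtain ⟨n, hn⟩ := hq _ hq'
        have : phi0 q' = (n * nq) • (1 : Lambda3) := by
          rw [phi0_eq, hn, hnq, ← Int.cast_smul_eq_zsmul ℚ]; push_cast; rfl
        rw [this]
        exact AddSubgroup.zsmul_mem _ (AddSubgroup.subset_closure (by simp)) _
      · refine span_aux iota1 _ b (fun i => AddSubgroup.subset_closure ?_) (hL1 hv)
        fin_cases i <;> simp
      · refine span_aux phi2 _ u (fun i => ?_) (hL2 hw)
        fin_cases i
        · exact sign_closure hs0 (AddSubgroup.subset_closure (by simp))
        · exact sign_closure hs1 (AddSubgroup.subset_closure (by simp))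
        · exact sign_closure hs2 (AddSubgroup.subset_closure (by simp))
      · obtain ⟨n, rfl⟩ := hg _ ht
        rw [← zsmul_eq_mul, map_zsmul]
        exact AddSubgroup.zsmul_mem _
          (sign_closure hs3 (AddSubgroup.subset_closure (by simp))) _
    · rw [AddSubgroup.closure_le]
      intro x hx
      simp only [Set.mem_insert_iff, Set.mem_singleton_iff] at hx
      rcases hx with rfl | rfl | rfl | rfl | rfl | rfl | rfl | rfl
      · exact (hmem _).2 A.one_mem
      · exact hb 0
      · exact hb 1
      · exact hb 2
      · exact S.zsmul_mem (hu 2) _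
      · exact S.zsmul_mem (hu 1) _
      · exact S.zsmul_mem (hu 0) _
      · exact S.zsmul_mem hgS _

end
end
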